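/- arXiv:1607.00469 — 5 statements merged into one kernel-verified Lean document; each statement's English description precedes it below -/
import Mathlib

section
/- There is an absolute constant C such that for all real D ≥ 1, all positive integers N, and all complex numbers α_1, …, α_N: ∑_{D < d ≤ 2D, d odd} ∑_{v ∈ {0,…,d−1}, d ∣ v²+3} |∑_{n ≤ N} α_n e(vn/d)|² ≤ C (D + N) ∑_{n ≤ N} |α_n|². -/
open Finset in
/-- A box of coefficient vectors `(a, b, c)` of binary quadratic forms `a x² + 2b xy + c y²`. -/
@[irreducible] noncomputable def formBox (R : ℤ) : Finset (ℤ × ℤ × ℤ) :=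
  Icc 0 R ×ˢ Icc (-R) R ×ˢ Icc 0 R

open Finset in
theorem mem_formBox_of_reduced {a b c R : ℤ} (h1 : 2 * b ≤ a) (h2 : -(2 * b) ≤ a) (h3 : 2 * b ≤ c)
    (h4 : -(2 * b) ≤ c) (ha : 0 < a) (hc : 0 < c) {q : ℤ × ℤ × ℤ} (hx : 0 < q.1) (hz : 0 < q.2.2)
    (hd : q.1 * q.2.2 - q.2.1 ^ 2 = 3) (hB : a * q.2.2 + q.1 * c - 2 * b * q.2.1 ≤ R) :
    q ∈ formBox (2 * R) := by
  obtain ⟨x, y, z⟩ := q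
  simp only at hx hz hd hB
  have hy : 2 * |y| ≤ x + z := by
    have : (2 * |y|) ^ 2 ≤ (x + z) ^ 2 := by
      rw [mul_pow, sq_abs]; nlinarith [sq_nonneg (x - z)]
    exact abs_le_of_sq_le_sq' this (by linarith) |>.2
  have hba : 2 * |b| ≤ a := by
    rcases abs_cases b with h | h <;> linarith
  have hbc : 2 * |b| ≤ c := by
    rcases abs_cases b with h | h <;> linarith
  have hby : 2 * (b * y) ≤ |b| * (x + z) := by
    have : b * y ≤ |b| * |y| := by rw [← abs_mul]; exact le_abs_self _
    nlinarith [abs_nonneg b]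
  have hsum : x + z ≤ 2 * R := by
    nlinarith [mul_le_mul_of_nonneg_right hba hz.le, mul_le_mul_of_nonneg_right hbc hx.le,
      mul_le_mul_of_nonneg_right (show 1 ≤ a by omega) hz.le,
      mul_le_mul_of_nonneg_right (show 1 ≤ c by omega) hx.le]
  have hy' := abs_le.1 (show |y| ≤ 2 * R by linarith)
  have hx' : x ∈ Icc 0 (2 * R) := mem_Icc.2 ⟨by linarith, by linarith⟩
  have hz' : z ∈ Icc 0 (2 * R) := mem_Icc.2 ⟨by linarith, by linarith⟩
  rw [formBox]
  exact mk_mem_product hx' (mk_mem_product (mem_Icc.2 hy') hz')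

open Finset in
/-- Around a fixed positive definite integral form `a x² + 2b xy + c y²` of determinant `3`, only
boundedly many such forms have a bounded joint invariant `a c' + a' c - 2 b b'` with it. -/
theorem card_forms_le (R : ℤ) (n : ℕ) : ∀ a b c : ℤ, 0 < a → 0 < c → a * c - b ^ 2 = 3 →
    a + c ≤ n →
    ∀ S : Finset (ℤ × ℤ × ℤ), (∀ q ∈ S, 0 < q.1 ∧ 0 < q.2.2 ∧ q.1 * q.2.2 - q.2.1 ^ 2 = 3 ∧
      a * q.2.2 + q.1 * c - 2 * b * q.2.1 ≤ R) →
    #S ≤ #(formBox (2 * R)) := by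
  induction n with
  | zero => intro a b c ha hc _ h; push_cast at h; omega
  | succ n ih =>
    intro a b c ha hc hdet hn S hS
    push_cast at hn
    have pos_of_det : ∀ x y z : ℤ, 0 < x → x * z - y ^ 2 = 3 → 0 < z := by
      intro x y z hx h
      by_contra! hz
      nlinarith [mul_nonneg hx.le (neg_nonneg.2 hz), sq_nonneg y]
    -- a substitution `x ↦ x + k y` or `y ↦ y + k x` preserves the joint invariant
    have shear_right : ∀ k : ℤ, a + (c + 2 * k * b + k ^ 2 * a) ≤ n →
        #S ≤ #(formBox (2 * R)) := by
      intro k hk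
      let f : ℤ × ℤ × ℤ → ℤ × ℤ × ℤ :=
        fun q ↦ (q.1, q.2.1 + k * q.1, q.2.2 + 2 * k * q.2.1 + k ^ 2 * q.1)
      have hf : Function.Injective f := by
        rintro ⟨x, y, z⟩ ⟨x', y', z'⟩ h
        simp only [f, Prod.mk.injEq] at h
        obtain ⟨rfl, h2, h3⟩ := h
        obtain rfl : y = y' := by linarith
        obtain rfl : z = z' := by linarith
        rfl
      rw [← card_image_of_injective S hf]
      have hdet' : a * (c + 2 * k * b + k ^ 2 * a) - (b + k * a) ^ 2 = 3 := by
        rw [← hdet]; ring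
      refine ih a (b + k * a) _ ha (pos_of_det _ _ _ ha hdet') hdet' hk _ ?_
      intro q hq
      obtain ⟨⟨x, y, z⟩, hp, rfl⟩ := mem_image.1 hq
      obtain ⟨h1, h2, h3, h4⟩ := hS _ hp
      have h3' : x * (z + 2 * k * y + k ^ 2 * x) - (y + k * x) ^ 2 = 3 := by
        rw [← h3]; ring
      refine ⟨h1, pos_of_det _ _ _ h1 h3', h3', ?_⟩
      refine le_of_eq_of_le ?_ h4
      simp only [f]; ring
    have shear_left : ∀ k : ℤ, (a + 2 * k * b + k ^ 2 * c) + c ≤ n →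
        #S ≤ #(formBox (2 * R)) := by
      intro k hk
      let f : ℤ × ℤ × ℤ → ℤ × ℤ × ℤ :=
        fun q ↦ (q.1 + 2 * k * q.2.1 + k ^ 2 * q.2.2, q.2.1 + k * q.2.2, q.2.2)
      have hf : Function.Injective f := by
        rintro ⟨x, y, z⟩ ⟨x', y', z'⟩ h
        simp only [f, Prod.mk.injEq] at h
        obtain ⟨h1, h2, rfl⟩ := h
        obtain rfl : y = y' := by linarith
        obtain rfl : x = x' := by linarith
        rfl
      rw [← card_image_of_injective S hf]
      have hdet' : (a + 2 * k * b + k ^ 2 * c) * c - (b + k * c) ^ 2 = 3 := by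
        rw [← hdet]; ring
      refine ih _ (b + k * c) c (pos_of_det _ _ _ hc (by rw [mul_comm]; exact hdet')) hc
        hdet' hk _ ?_
      intro q hq
      obtain ⟨⟨x, y, z⟩, hp, rfl⟩ := mem_image.1 hq
      obtain ⟨h1, h2, h3, h4⟩ := hS _ hp
      have h3' : (x + 2 * k * y + k ^ 2 * z) * z - (y + k * z) ^ 2 = 3 := by
        rw [← h3]; ring
      refine ⟨pos_of_det _ _ _ h2 (by rw [mul_comm]; exact h3'), h2, h3', ?_⟩
      refine le_of_eq_of_le ?_ h4
      simp only [f]; ring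
    by_cases h1 : a < 2 * b
    · exact shear_right (-1) (by linarith)
    by_cases h2 : a < -(2 * b)
    · exact shear_right 1 (by linarith)
    by_cases h3 : c < 2 * b
    · exact shear_left (-1) (by linarith)
    by_cases h4 : c < -(2 * b)
    · exact shear_left 1 (by linarith)
    push Not at h1 h2 h3 h4
    refine card_le_card fun q hq ↦ ?_
    obtain ⟨h5, h6, h7, h8⟩ := hS q hq
    exact mem_formBox_of_reduced (by linarith) (by linarith) (by linarith) (by linarith) ha hc
      h5 h6 h7 h8

/-- The additive character `e(θ) = exp(2πiθ)`. -/
noncomputable def expTwoPi (θ : ℝ) : ℂ := Complex.exp ((2 * Real.pi * θ : ℝ) * Complex.I)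

theorem expTwoPi_add (x y : ℝ) : expTwoPi (x + y) = expTwoPi x * expTwoPi y := by
  rw [expTwoPi, expTwoPi, expTwoPi, ← Complex.exp_add]
  congr 1
  push_cast
  ring

theorem expTwoPi_nat_mul (m : ℕ) (x : ℝ) : expTwoPi (m * x) = expTwoPi x ^ m := by
  rw [expTwoPi, expTwoPi, ← Complex.exp_nat_mul]
  congr 1
  push_cast
  ring

theorem norm_expTwoPi (x : ℝ) : ‖expTwoPi x‖ = 1 := Complex.norm_exp_ofReal_mul_I _

theorem expTwoPi_neg (x : ℝ) : expTwoPi (-x) = (starRingEnd ℂ) (expTwoPi x) := by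
  rw [expTwoPi, expTwoPi, ← Complex.exp_conj]
  rw [map_mul, Complex.conj_ofReal, Complex.conj_I]
  congr 1
  push_cast
  ring

theorem expTwoPi_add_int (x : ℝ) (k : ℤ) : expTwoPi (x + k) = expTwoPi x := by
  rw [expTwoPi, expTwoPi, Complex.exp_eq_exp_iff_exists_int]
  exact ⟨k, by push_cast; ring⟩

theorem four_mul_abs_le_norm_expTwoPi_sub_one {y : ℝ} (hy : |y| ≤ 1 / 2) :
    4 * |y| ≤ ‖expTwoPi y - 1‖ := by
  have hnorm : ‖expTwoPi y - 1‖ = ‖2 * Real.sin (Real.pi * y)‖ := by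
    rw [expTwoPi, mul_comm, Complex.norm_exp_I_mul_ofReal_sub_one]
    congr 3
    ring
  have hsin : 2 * |y| ≤ |Real.sin (Real.pi * y)| := by
    have h := Real.mul_abs_le_abs_sin (x := Real.pi * y) (by
      rw [abs_mul, abs_of_pos Real.pi_pos]; nlinarith [Real.pi_pos])
    rw [abs_mul, abs_of_pos Real.pi_pos] at h
    have : 2 / Real.pi * (Real.pi * |y|) = 2 * |y| := by field_simp
    linarith
  rw [hnorm, Real.norm_eq_abs, abs_mul, abs_two]
  linarith

open Finset in
theorem norm_sq_geom_sum_mul_le {y D : ℝ} {M : ℕ} (hy : |y| ≤ 1 / 2) (hD : 0 ≤ D) (hDM : D ≤ M) :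
    ‖∑ m ∈ range (2 * M), expTwoPi (m * y)‖ ^ 2 * (1 + (⌊y * D⌋ : ℝ) ^ 2) ≤ 20 * M ^ 2 := by
  simp only [expTwoPi_nat_mul]
  set g := ‖∑ m ∈ range (2 * M), expTwoPi y ^ m‖ with hg
  have hg0 : 0 ≤ g := norm_nonneg _
  have h1 : g ≤ 2 * M := by
    refine (norm_sum_le _ _).trans ?_
    simp [norm_expTwoPi]
  have h2 : g * (4 * |y|) ≤ 2 := by
    calc g * (4 * |y|) ≤ g * ‖expTwoPi y - 1‖ := by
          gcongr; exact four_mul_abs_le_norm_expTwoPi_sub_one hy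
      _ = ‖expTwoPi y ^ (2 * M) - 1‖ := by rw [hg, ← norm_mul, geom_sum_mul]
      _ ≤ 2 := by
          refine (norm_sub_le _ _).trans ?_
          simp only [norm_pow, norm_expTwoPi, one_pow, norm_one]
          norm_num
  have h3 : (⌊y * D⌋ : ℝ) ^ 2 ≤ 2 * (y * D) ^ 2 + 2 := by
    have ha := Int.floor_le (y * D)
    have hb := Int.lt_floor_add_one (y * D)
    nlinarith [sq_nonneg (y * D - 1), sq_nonneg (y * D + 1), sq_nonneg (⌊y * D⌋ - 2 * (y * D))]
  have h4 : g ^ 2 ≤ 4 * M ^ 2 := by nlinarith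
  have h5 : g ^ 2 * y ^ 2 ≤ 1 / 4 := by
    have : (g * (4 * |y|)) ^ 2 ≤ 2 ^ 2 := by gcongr
    rw [mul_pow, mul_pow, sq_abs] at this
    linarith
  have h6 : D ^ 2 ≤ (M : ℝ) ^ 2 := by gcongr
  nlinarith [mul_le_mul_of_nonneg_left h3 (sq_nonneg g),
    mul_le_mul_of_nonneg_right h5 (sq_nonneg D)]

/-- The sum over the integers that controls the off-diagonal terms in the large sieve. -/
noncomputable def sumInvOneAddSq : ℝ := ∑' l : ℤ, 1 / (1 + (l : ℝ) ^ 2)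

theorem summable_inv_one_add_sq : Summable fun l : ℤ ↦ 1 / (1 + (l : ℝ) ^ 2) := by
  refine Summable.of_norm_bounded_eventually (g := fun l : ℤ ↦ 1 / (l : ℝ) ^ 2)
    (Real.summable_one_div_int_pow.2 one_lt_two) ?_
  rw [Filter.eventually_cofinite]
  refine (Set.finite_singleton (0 : ℤ)).subset fun l hl ↦ ?_
  by_contra h
  have hpos : (0 : ℝ) < (l : ℝ) ^ 2 := by
    have : (l : ℝ) ≠ 0 := by exact_mod_cast h
    positivity
  apply hl
  rw [Real.norm_of_nonneg (by positivity)]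
  gcongr
  linarith

open Finset in
theorem sum_inv_one_add_floor_sq_le {ι : Type*} (s : Finset ι) (θ : ι → ℝ) {D : ℝ} (K : ℕ)
    (hK : ∀ t ⊆ s, (∀ i ∈ t, ∀ j ∈ t, |θ i - θ j| * D ≤ 1) → #t ≤ K) (hD : 0 ≤ D) (x : ℝ) :
    ∑ i ∈ s, 1 / (1 + (⌊(θ i + x) * D⌋ : ℝ) ^ 2) ≤ K * sumInvOneAddSq := by
  classical
  let f : ι → ℤ := fun i ↦ ⌊(θ i + x) * D⌋
  calc ∑ i ∈ s, 1 / (1 + (f i : ℝ) ^ 2)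
      = ∑ l ∈ s.image f, ∑ i ∈ s with f i = l, 1 / (1 + (f i : ℝ) ^ 2) :=
        (sum_fiberwise_of_maps_to (fun i hi ↦ mem_image_of_mem f hi) _).symm
    _ ≤ ∑ l ∈ s.image f, K * (1 / (1 + (l : ℝ) ^ 2)) := by
        refine sum_le_sum fun l _ ↦ ?_
        have hsum : ∑ i ∈ s with f i = l, 1 / (1 + (f i : ℝ) ^ 2)
            = #{i ∈ s | f i = l} * (1 / (1 + (l : ℝ) ^ 2)) := by
          rw [← nsmul_eq_mul, ← sum_const]
          refine sum_congr rfl fun i hi ↦ ?_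
          rw [(mem_filter.1 hi).2]
        rw [hsum]
        gcongr
        refine hK _ (filter_subset _ _) fun i hi j hj ↦ ?_
        have h := Int.abs_sub_lt_one_of_floor_eq_floor
          ((mem_filter.1 hi).2.trans (mem_filter.1 hj).2.symm)
        rw [← sub_mul, add_sub_add_right_eq_sub, abs_mul, abs_of_nonneg hD] at h
        exact h.le
    _ = K * ∑ l ∈ s.image f, 1 / (1 + (l : ℝ) ^ 2) := by rw [mul_sum]
    _ ≤ K * sumInvOneAddSq := by
        gcongr
        exact summable_inv_one_add_sq.sum_le_tsum _ fun l _ ↦ by positivity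

open Finset in
theorem norm_sq_geom_sum_le {y D : ℝ} {M : ℕ} (hy : |y| < 1) (hD : 0 ≤ D) (hDM : D ≤ M) :
    ‖∑ m ∈ range (2 * M), expTwoPi (m * y)‖ ^ 2
      ≤ 20 * M ^ 2 * ∑ k ∈ Icc (-1 : ℤ) 1, 1 / (1 + (⌊(y + k) * D⌋ : ℝ) ^ 2) := by
  obtain ⟨k, hk, hyk⟩ : ∃ k ∈ Icc (-1 : ℤ) 1, |y + k| ≤ 1 / 2 := by
    rw [abs_lt] at hy
    rcases le_or_gt y (-1 / 2) with h | h
    · exact ⟨1, by simp, by rw [abs_le]; push_cast; constructor <;> linarith⟩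
    rcases le_or_gt y (1 / 2) with h' | h'
    · exact ⟨0, by simp, by rw [abs_le]; push_cast; constructor <;> linarith⟩
    · exact ⟨-1, by simp, by rw [abs_le]; push_cast; constructor <;> linarith⟩
  have h := norm_sq_geom_sum_mul_le hyk hD hDM
  have hper : ∀ m : ℕ, expTwoPi (m * (y + k)) = expTwoPi (m * y) := fun m ↦ by
    rw [expTwoPi_nat_mul, expTwoPi_add_int, ← expTwoPi_nat_mul]
  simp only [hper] at h
  calc _ ≤ 20 * (M : ℝ) ^ 2 * (1 / (1 + (⌊(y + k) * D⌋ : ℝ) ^ 2)) := by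
        rw [mul_one_div, le_div_iff₀ (by positivity)]
        exact h
    _ ≤ _ := by
        gcongr
        exact single_le_sum (f := fun k : ℤ ↦ 1 / (1 + (⌊(y + k) * D⌋ : ℝ) ^ 2))
          (fun _ _ ↦ by positivity) hk

open Finset in
/-- Averaging over differences turns the square mean of an exponential sum into a quadratic form
in Fejér kernels. -/
theorem sum_norm_sq_eq_fejer {ι : Type*} (s : Finset ι) (θ : ι → ℝ) (c : ι → ℂ) (L : ℕ) :
    ((∑ m ∈ range L, ∑ m' ∈ range L,
        ‖∑ i ∈ s, c i * expTwoPi ((m - m' : ℝ) * θ i)‖ ^ 2 : ℝ) : ℂ)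
      = ∑ i ∈ s, ∑ j ∈ s, (starRingEnd ℂ) (c i) * c j *
          (‖∑ m ∈ range L, expTwoPi (m * (θ j - θ i))‖ ^ 2 : ℝ) := by
  have hker : ∀ i j, ((‖∑ m ∈ range L, expTwoPi (m * (θ j - θ i))‖ ^ 2 : ℝ) : ℂ)
      = ∑ m ∈ range L, ∑ m' ∈ range L,
        expTwoPi ((m - m' : ℝ) * θ j) * (starRingEnd ℂ) (expTwoPi ((m - m' : ℝ) * θ i)) := by
    intro i j
    rw [Complex.ofReal_pow, ← Complex.mul_conj', map_sum, sum_mul_sum]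
    refine sum_congr rfl fun m _ ↦ sum_congr rfl fun m' _ ↦ ?_
    rw [← expTwoPi_neg, ← expTwoPi_neg, ← expTwoPi_add, ← expTwoPi_add]
    congr 1
    ring
  have hsq : ∀ x : ℝ, ((‖∑ i ∈ s, c i * expTwoPi (x * θ i)‖ ^ 2 : ℝ) : ℂ)
      = ∑ i ∈ s, ∑ j ∈ s, (starRingEnd ℂ) (c i) * c j *
        (expTwoPi (x * θ j) * (starRingEnd ℂ) (expTwoPi (x * θ i))) := by
    intro x
    rw [Complex.ofReal_pow, ← Complex.conj_mul', map_sum, sum_mul_sum]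
    refine sum_congr rfl fun m _ ↦ sum_congr rfl fun m' _ ↦ ?_
    rw [map_mul]
    ring
  rw [Complex.ofReal_sum]
  simp only [Complex.ofReal_sum, hsq, hker, mul_sum]
  rw [sum_congr rfl fun m _ ↦ sum_comm, sum_comm]
  refine sum_congr rfl fun i _ ↦ ?_
  rw [sum_congr rfl fun m _ ↦ sum_comm, sum_comm]

open Finset in
/-- The dual large sieve. -/
theorem dual_large_sieve {ι : Type*} (s : Finset ι) (θ : ι → ℝ) (hθ : ∀ i ∈ s, θ i ∈ Set.Ico 0 1)
    {D : ℝ} (hD : 0 ≤ D) {K M : ℕ} (hM : 0 < M) (hDM : D ≤ M)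
    (hK : ∀ t ⊆ s, (∀ i ∈ t, ∀ j ∈ t, |θ i - θ j| * D ≤ 1) → #t ≤ K) (c : ι → ℂ) :
    ∑ n ∈ Icc 1 M, ‖∑ i ∈ s, c i * expTwoPi (n * θ i)‖ ^ 2
      ≤ 60 * K * sumInvOneAddSq * M * ∑ i ∈ s, ‖c i‖ ^ 2 := by
  let G : ι → ι → ℝ := fun i j ↦ ‖∑ m ∈ range (2 * M), expTwoPi (m * (θ j - θ i))‖ ^ 2
  have hGsymm : ∀ i j, G i j = G j i := by
    intro i j
    simp only [G]
    rw [← RCLike.norm_conj, map_sum]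
    congr 2
    refine sum_congr rfl fun m _ ↦ ?_
    rw [← expTwoPi_neg]
    congr 1
    ring
  have hrow : ∀ i ∈ s, ∑ j ∈ s, G i j ≤ 60 * K * sumInvOneAddSq * M ^ 2 := by
    intro i hi
    calc ∑ j ∈ s, G i j ≤ ∑ j ∈ s, 20 * (M : ℝ) ^ 2 *
          ∑ k ∈ Icc (-1 : ℤ) 1, 1 / (1 + (⌊(θ j + (k - θ i)) * D⌋ : ℝ) ^ 2) := by
          refine sum_le_sum fun j hj ↦ ?_
          have hy : |θ j - θ i| < 1 := by
            have h1 := hθ i hi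
            have h2 := hθ j hj
            rw [abs_lt]
            constructor <;> linarith [h1.1, h1.2, h2.1, h2.2]
          have hshift : ∀ k : ℤ, θ j + (k - θ i) = θ j - θ i + k := fun k ↦ by ring
          simp only [hshift]
          exact norm_sq_geom_sum_le hy hD hDM
      _ = 20 * (M : ℝ) ^ 2 * ∑ k ∈ Icc (-1 : ℤ) 1,
            ∑ j ∈ s, 1 / (1 + (⌊(θ j + (k - θ i)) * D⌋ : ℝ) ^ 2) := by
          rw [← mul_sum, sum_comm]
      _ ≤ 20 * (M : ℝ) ^ 2 * ∑ k ∈ Icc (-1 : ℤ) 1, K * sumInvOneAddSq := by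
          gcongr with k _
          exact sum_inv_one_add_floor_sq_le s θ K hK hD _
      _ = 60 * K * sumInvOneAddSq * M ^ 2 := by
          rw [sum_const, show #(Icc (-1 : ℤ) 1) = 3 from rfl]
          ring
  have hquad : ∑ m ∈ range (2 * M), ∑ m' ∈ range (2 * M),
        ‖∑ i ∈ s, c i * expTwoPi ((m - m' : ℝ) * θ i)‖ ^ 2
      ≤ 60 * K * sumInvOneAddSq * M ^ 2 * ∑ i ∈ s, ‖c i‖ ^ 2 := by
    calc _ = ‖((∑ m ∈ range (2 * M), ∑ m' ∈ range (2 * M),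
        ‖∑ i ∈ s, c i * expTwoPi ((m - m' : ℝ) * θ i)‖ ^ 2 : ℝ) : ℂ)‖ := by
          rw [Complex.norm_of_nonneg (by positivity)]
      _ ≤ ∑ i ∈ s, ∑ j ∈ s, ‖c i‖ * ‖c j‖ * G i j := by
          rw [sum_norm_sq_eq_fejer]
          refine (norm_sum_le _ _).trans (sum_le_sum fun i _ ↦
            (norm_sum_le _ _).trans (sum_le_sum fun j _ ↦ ?_))
          rw [norm_mul, norm_mul, RCLike.norm_conj, Complex.norm_of_nonneg (by positivity)]
      _ ≤ ∑ i ∈ s, ∑ j ∈ s, (‖c i‖ ^ 2 * G i j / 2 + ‖c j‖ ^ 2 * G j i / 2) := by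
          refine sum_le_sum fun i _ ↦ sum_le_sum fun j _ ↦ ?_
          rw [hGsymm j i]
          have : 0 ≤ G i j := by positivity
          nlinarith [mul_nonneg (sq_nonneg (‖c i‖ - ‖c j‖)) this]
      _ = ∑ i ∈ s, ‖c i‖ ^ 2 * ∑ j ∈ s, G i j := by
          simp only [sum_add_distrib]
          rw [sum_comm (f := fun i j ↦ ‖c j‖ ^ 2 * G j i / 2), ← sum_add_distrib]
          refine sum_congr rfl fun i _ ↦ ?_
          rw [← sum_add_distrib, mul_sum]
          exact sum_congr rfl fun j _ ↦ by ring
      _ ≤ ∑ i ∈ s, ‖c i‖ ^ 2 * (60 * K * sumInvOneAddSq * M ^ 2) := by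
          gcongr with i hi
          exact hrow i hi
      _ = _ := by rw [← sum_mul, mul_comm]
  have hlower : M * ∑ n ∈ Icc 1 M, ‖∑ i ∈ s, c i * expTwoPi (n * θ i)‖ ^ 2
      ≤ ∑ m ∈ range (2 * M), ∑ m' ∈ range (2 * M),
        ‖∑ i ∈ s, c i * expTwoPi ((m - m' : ℝ) * θ i)‖ ^ 2 := by
    rw [sum_comm]
    calc _ = ∑ m' ∈ range M, ∑ n ∈ Icc 1 M, ‖∑ i ∈ s, c i * expTwoPi (n * θ i)‖ ^ 2 := by
          rw [sum_const, card_range, nsmul_eq_mul]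
      _ ≤ ∑ m' ∈ range M, ∑ m ∈ range (2 * M),
            ‖∑ i ∈ s, c i * expTwoPi ((m - m' : ℝ) * θ i)‖ ^ 2 := by
          refine sum_le_sum fun m' hm' ↦ ?_
          have hinj : Set.InjOn (fun n : ℕ ↦ n + m') (Icc 1 M) :=
            fun x _ y _ h ↦ Nat.add_right_cancel h
          have hsub : (Icc 1 M).image (fun n ↦ n + m') ⊆ range (2 * M) := by
            intro m hm
            obtain ⟨n, hn, rfl⟩ := mem_image.1 hm
            rw [mem_Icc] at hn
            rw [mem_range] at hm' ⊢
            omega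
          refine le_trans (le_of_eq ?_) (sum_le_sum_of_subset_of_nonneg hsub
            fun _ _ _ ↦ by positivity)
          rw [sum_image hinj]
          refine sum_congr rfl fun n _ ↦ ?_
          push_cast
          simp only [add_sub_cancel_right]
      _ ≤ _ := sum_le_sum_of_subset_of_nonneg (range_mono (by omega))
            fun _ _ _ ↦ by positivity
  have hM' : (0 : ℝ) < M := by exact_mod_cast hM
  refine le_of_mul_le_mul_left (hlower.trans (hquad.trans (le_of_eq ?_))) hM'
  ring

open Finset in
/-- The large sieve inequality for points of `[0, 1)` of which at most `K` lie in any interval of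
length `1 / D`. -/
theorem large_sieve_of_card_le {ι : Type*} (s : Finset ι) (θ : ι → ℝ)
    (hθ : ∀ i ∈ s, θ i ∈ Set.Ico 0 1) {D : ℝ} (hD : 0 ≤ D) {K M N : ℕ} (hM : 0 < M) (hDM : D ≤ M)
    (hNM : N ≤ M) (hK : ∀ t ⊆ s, (∀ i ∈ t, ∀ j ∈ t, |θ i - θ j| * D ≤ 1) → #t ≤ K) (α : ℕ → ℂ) :
    ∑ i ∈ s, ‖∑ n ∈ Icc 1 N, α n * expTwoPi (n * θ i)‖ ^ 2
      ≤ 60 * K * sumInvOneAddSq * M * ∑ n ∈ Icc 1 N, ‖α n‖ ^ 2 := by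
  let S : ι → ℂ := fun i ↦ ∑ n ∈ Icc 1 N, α n * expTwoPi (n * θ i)
  let T : ℕ → ℂ := fun n ↦ ∑ i ∈ s, (starRingEnd ℂ) (S i) * expTwoPi (n * θ i)
  set X := ∑ i ∈ s, ‖S i‖ ^ 2 with hX
  change X ≤ _
  have hdual : ∑ n ∈ Icc 1 N, ‖T n‖ ^ 2 ≤ 60 * K * sumInvOneAddSq * M * X := by
    have h := dual_large_sieve s θ hθ hD hM hDM hK fun i ↦ (starRingEnd ℂ) (S i)
    simp only [RCLike.norm_conj] at h
    exact (sum_le_sum_of_subset_of_nonneg (Icc_subset_Icc_right hNM)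
      fun _ _ _ ↦ by positivity).trans h
  have hXT : (X : ℂ) = ∑ n ∈ Icc 1 N, α n * T n := by
    rw [hX, Complex.ofReal_sum]
    simp only [T, mul_sum]
    rw [sum_comm]
    refine sum_congr rfl fun i _ ↦ ?_
    rw [Complex.ofReal_pow, ← Complex.conj_mul', mul_sum]
    exact sum_congr rfl fun n _ ↦ by ring
  have hX0 : 0 ≤ X := by positivity
  have hXle : X ≤ ∑ n ∈ Icc 1 N, ‖α n‖ * ‖T n‖ := by
    rw [← Complex.norm_of_nonneg hX0, hXT]
    refine (norm_sum_le _ _).trans (le_of_eq ?_)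
    simp only [norm_mul]
  have hsq : X ^ 2 ≤ (60 * K * sumInvOneAddSq * M * ∑ n ∈ Icc 1 N, ‖α n‖ ^ 2) * X := by
    calc X ^ 2 ≤ (∑ n ∈ Icc 1 N, ‖α n‖ * ‖T n‖) ^ 2 := by gcongr
      _ ≤ (∑ n ∈ Icc 1 N, ‖α n‖ ^ 2) * ∑ n ∈ Icc 1 N, ‖T n‖ ^ 2 :=
          sum_mul_sq_le_sq_mul_sq _ _ _
      _ ≤ (∑ n ∈ Icc 1 N, ‖α n‖ ^ 2) * (60 * K * sumInvOneAddSq * M * X) := by gcongr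
      _ = _ := by ring
  rcases hX0.eq_or_lt with h | h
  · rw [← h]
    have : 0 ≤ sumInvOneAddSq := tsum_nonneg fun l ↦ by positivity
    positivity
  · rw [sq] at hsq
    exact le_of_mul_le_mul_right hsq h

open Finset in
/-- Boundedly many fractions `v / d` with `d ∣ v² + 3`, `D < d ≤ 2D`, lie in an interval of length
`1 / D`. -/
theorem card_roots_le {D : ℝ} (hD : 0 < D) (t : Finset (Σ _ : ℕ, ℕ))
    (ht : ∀ p ∈ t, D < p.1 ∧ (p.1 : ℝ) ≤ 2 * D ∧ p.1 ∣ p.2 ^ 2 + 3)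
    (hclose : ∀ p ∈ t, ∀ q ∈ t, |(p.2 / p.1 : ℝ) - q.2 / q.1| * D ≤ 1) :
    #t ≤ #(formBox (2 * 16)) := by
  rcases t.eq_empty_or_nonempty with rfl | ⟨p, hp⟩
  · simp
  let f : (Σ _ : ℕ, ℕ) → ℤ × ℤ × ℤ := fun q ↦ (q.1, q.2, ((q.2 ^ 2 + 3) / q.1 : ℕ))
  have hf : Function.Injective f := by
    rintro ⟨d, v⟩ ⟨d', v'⟩ h
    simp only [f, Prod.mk.injEq, Nat.cast_inj] at h
    obtain ⟨rfl, rfl, -⟩ := h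
    rfl
  have hdet : ∀ q ∈ t, (q.1 : ℤ) * ((q.2 ^ 2 + 3) / q.1 : ℕ) = (q.2 : ℤ) ^ 2 + 3 := by
    intro q hq
    exact_mod_cast Nat.mul_div_cancel' (ht q hq).2.2
  have hpos : ∀ q ∈ t, (0 : ℤ) < q.1 ∧ (0 : ℤ) < ((q.2 ^ 2 + 3) / q.1 : ℕ) := by
    intro q hq
    have h : 0 < q.1 := by exact_mod_cast hD.trans (ht q hq).1
    exact ⟨by exact_mod_cast h, by
      exact_mod_cast Nat.div_pos (Nat.le_of_dvd (by positivity) (ht q hq).2.2) h⟩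
  rw [← card_image_of_injective t hf]
  refine card_forms_le 16 _ p.1 p.2 ((p.2 ^ 2 + 3) / p.1 : ℕ) (hpos p hp).1 (hpos p hp).2
    (by rw [hdet p hp]; ring) (Int.self_le_toNat _) _ ?_
  intro r hr
  obtain ⟨q, hq, rfl⟩ := mem_image.1 hr
  refine ⟨(hpos q hq).1, (hpos q hq).2, by simp only [f]; rw [hdet q hq]; ring, ?_⟩
  have hp' := hdet p hp
  have hq' := hdet q hq
  have hc := hclose p hp q hq
  obtain ⟨hp1, hp2, -⟩ := ht p hp
  obtain ⟨hq1, hq2, -⟩ := ht q hq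
  simp only [f]
  generalize (((p.2 ^ 2 + 3) / p.1 : ℕ) : ℤ) = e at *
  generalize (((q.2 ^ 2 + 3) / q.1 : ℕ) : ℤ) = e' at *
  obtain ⟨d, v⟩ := p
  obtain ⟨d', v'⟩ := q
  simp only at *
  have hpR : (d : ℝ) * e = v ^ 2 + 3 := by exact_mod_cast hp'
  have hqR : (d' : ℝ) * e' = v' ^ 2 + 3 := by exact_mod_cast hq'
  have hd : (0 : ℝ) < d := hD.trans hp1
  have hd' : (0 : ℝ) < d' := hD.trans hq1
  have hcross : ((v : ℝ) * d' - v' * d) ^ 2 ≤ 4 * (d * d') := by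
    have h1 : (((v : ℝ) / d - v' / d') * D) ^ 2 ≤ 1 := by
      rw [← sq_abs, abs_mul, abs_of_pos hD]
      exact pow_le_one₀ (by positivity) hc
    have h2 : (v : ℝ) * d' - v' * d = (v / d - v' / d') * (d * d') := by field_simp
    have h3 : (d : ℝ) * d' ≤ 4 * D ^ 2 := by nlinarith
    calc ((v : ℝ) * d' - v' * d) ^ 2 = ((v : ℝ) / d - v' / d') ^ 2 * (d * d') * (d * d') := by
          rw [h2]; ring
      _ ≤ ((v : ℝ) / d - v' / d') ^ 2 * (4 * D ^ 2) * (d * d') := by gcongr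
      _ = 4 * (((v : ℝ) / d - v' / d') * D) ^ 2 * (d * d') := by ring
      _ ≤ 4 * 1 * (d * d') := by gcongr
      _ = 4 * (d * d') := by ring
  have hsq : (d : ℝ) ^ 2 + d' ^ 2 ≤ 4 * (d * d') := by nlinarith
  have hkey : (d : ℝ) * d' * (d * e' + d' * e - 2 * v * v') ≤ d * d' * 16 := by
    have : (d : ℝ) * d' * (d * e' + d' * e - 2 * v * v')
        = (v * d' - v' * d) ^ 2 + 3 * (d ^ 2 + d' ^ 2) := by
      linear_combination (d : ℝ) ^ 2 * hqR + (d' : ℝ) ^ 2 * hpR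
    linarith
  exact_mod_cast le_of_mul_le_mul_left hkey (by positivity)

/-- Large sieve inequality for the roots of `v² + 3 ≡ 0 (mod d)`:
there is an absolute constant `C` such that for all `D ≥ 1`, `N ≥ 1` and complex
`α₁, …, α_N`,
`∑_{D < d ≤ 2D, d odd} ∑_{v² + 3 ≡ 0 (d)} |∑_{n ≤ N} αₙ e(vn/d)|² ≤ C (D + N) ∑ |αₙ|²`. -/
theorem large_sieve_sq :
    ∃ C : ℝ, ∀ D : ℝ, 1 ≤ D → ∀ N : ℕ, 0 < N → ∀ α : ℕ → ℂ,
      ∑ d ∈ (Finset.Icc 1 (Nat.floor (2 * D))).filter (fun d : ℕ => D < (d : ℝ) ∧ Odd d),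
        ∑ v ∈ (Finset.range d).filter (fun v => d ∣ v ^ 2 + 3),
          ‖∑ n ∈ Finset.Icc 1 N,
              α n * Complex.exp (2 * Real.pi * Complex.I * ((v : ℂ) * n / d))‖ ^ 2
        ≤ C * (D + N) * ∑ n ∈ Finset.Icc 1 N, ‖α n‖ ^ 2 := by
  refine ⟨60 * (formBox (2 * 16)).card * sumInvOneAddSq * 2, fun D hD N hN α ↦ ?_⟩
  have hD0 : 0 < D := by linarith
  rw [Finset.sum_sigma']
  set s := ((Finset.Icc 1 (Nat.floor (2 * D))).filter (fun d : ℕ => D < (d : ℝ) ∧ Odd d)).sigma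
    fun d ↦ (Finset.range d).filter (fun v => d ∣ v ^ 2 + 3) with hs
  have hmem : ∀ p ∈ s, D < p.1 ∧ (p.1 : ℝ) ≤ 2 * D ∧ p.1 ∣ p.2 ^ 2 + 3 ∧ p.2 < p.1 := by
    intro p hp
    simp only [hs, Finset.mem_sigma, Finset.mem_filter, Finset.mem_Icc, Finset.mem_range] at hp
    obtain ⟨⟨⟨-, h1⟩, h2, -⟩, h3, h4⟩ := hp
    exact ⟨h2, (Nat.le_floor_iff (by positivity)).1 h1, h4, h3⟩
  have hmain := large_sieve_of_card_le s (fun p ↦ (p.2 / p.1 : ℝ)) (D := D) (K := (formBox (2 * 16)).card)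
    (M := N + ⌈D⌉₊) (N := N) (fun p hp ↦ by
      obtain ⟨h1, -, -, h2⟩ := hmem p hp
      refine ⟨by positivity, ?_⟩
      rw [div_lt_one (hD0.trans h1)]
      exact_mod_cast h2) hD0.le (by omega)
    (by push_cast; linarith [Nat.le_ceil D, Nat.cast_nonneg (α := ℝ) N]) (by omega)
    (fun t ht hclose ↦ card_roots_le hD0 t (fun p hp ↦ by
      obtain ⟨h1, h2, h3, -⟩ := hmem p (ht hp)
      exact ⟨h1, h2, h3⟩) hclose) α
  have hexp : ∀ (p : Σ _ : ℕ, ℕ) (n : ℕ), expTwoPi (n * (p.2 / p.1 : ℝ))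
      = Complex.exp (2 * Real.pi * Complex.I * ((p.2 : ℂ) * n / p.1)) := by
    intro p n
    rw [expTwoPi]
    congr 1
    push_cast
    ring
  simp only [hexp] at hmain
  refine hmain.trans ?_
  have hsum0 : 0 ≤ sumInvOneAddSq := tsum_nonneg fun l ↦ by positivity
  have hM : ((N + ⌈D⌉₊ : ℕ) : ℝ) ≤ 2 * (D + N) := by
    push_cast
    linarith [Nat.ceil_lt_add_one hD0.le, Nat.cast_nonneg (α := ℝ) N]
  calc _ ≤ 60 * (formBox (2 * 16)).card * sumInvOneAddSq * (2 * (D + N)) *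
        ∑ n ∈ Finset.Icc 1 N, ‖α n‖ ^ 2 := by gcongr
    _ = _ := by ring
end

section
/- There is an absolute constant C such that for all real D ≥ 1, all positive integers N, and all complex numbers α_1, …, α_N: ∑_{D < d ≤ 2D, d odd} ∑_{v ∈ {0,…,d−1}, d ∣ v²+3} |∑_{n ≤ N} α_n e(vn/d)| ≤ C D^{1/2} (D + N)^{1/2} (∑_{n ≤ N} |α_n|²)^{1/2}. -/
/-- Distinct points `(v + i√3) / d` with `d ∣ v² + 3` are separated in the hyperbolic plane. -/
lemma mul_le_of_dvd_sq_add_three {d e v w : ℤ} (hd : 0 < d) (he : 0 < e)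
    (hv : d ∣ v ^ 2 + 3) (hw : e ∣ w ^ 2 + 3) (hne : ¬ (d = e ∧ v = w)) :
    d * e ≤ (v * e - w * d) ^ 2 + 3 * (d - e) ^ 2 := by
  obtain ⟨b, hb⟩ := hv
  obtain ⟨c, hc⟩ := hw
  have key : (v * e - w * d) ^ 2 + 3 * (d - e) ^ 2 =
      d * e * (b * e + c * d - 2 * (v * w + 3)) := by
    linear_combination e ^ 2 * hb + d ^ 2 * hc
  have hde : 0 < d * e := mul_pos hd he
  have hm : 0 < b * e + c * d - 2 * (v * w + 3) := by
    by_contra! hm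
    have h0 := mul_nonpos_of_nonneg_of_nonpos hde.le hm
    have h1 : (d - e) ^ 2 = 0 := by
      nlinarith [sq_nonneg (v * e - w * d), sq_nonneg (d - e)]
    have h2 : (v * e - w * d) ^ 2 = 0 := by
      nlinarith [sq_nonneg (v * e - w * d), sq_nonneg (d - e)]
    have h3 : d = e := by linarith [pow_eq_zero_iff (two_ne_zero) |>.mp h1]
    subst h3
    have h4 : (v - w) * d = 0 := by linarith [pow_eq_zero_iff (two_ne_zero) |>.mp h2]
    exact hne ⟨rfl, by linarith [(mul_eq_zero.mp h4).resolve_right hd.ne']⟩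
  rw [key]
  nlinarith

/-- Roots whose moduli lie in an interval of length `D / 2` to the right of `D` give
`1 / (8 D)`-separated fractions. -/
lemma one_le_abs_div_sub_div {D : ℝ} (hD : 0 < D) {d e v w : ℕ}
    (hd : D < d) (hd' : d ≤ 2 * D) (he : D < e) (he' : e ≤ 2 * D)
    (hde : |(d : ℝ) - e| ≤ D / 2)
    (hv : d ∣ v ^ 2 + 3) (hw : e ∣ w ^ 2 + 3) (hne : ¬ (d = e ∧ v = w)) :
    1 ≤ 8 * D * |(v : ℝ) / d - w / e| := by
  have hd0 : (0 : ℝ) < d := hD.trans hd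
  have he0 : (0 : ℝ) < e := hD.trans he
  have key : (d : ℝ) * e ≤ (v * e - w * d) ^ 2 + 3 * (d - e) ^ 2 := by
    exact_mod_cast mul_le_of_dvd_sq_add_three (d := d) (e := e) (v := v) (w := w)
      (by exact_mod_cast hd0) (by exact_mod_cast he0) (by exact_mod_cast hv)
      (by exact_mod_cast hw) (by exact_mod_cast hne)
  have h1 : ((d : ℝ) - e) ^ 2 ≤ (D / 2) ^ 2 := sq_le_sq' (by linarith [abs_le.mp hde])
    (abs_le.mp hde).2
  have h2 : D * D ≤ d * e := mul_le_mul hd.le he.le hD.le hd0.le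
  have h3 : D / 2 ≤ |(v : ℝ) * e - w * d| := by
    apply abs_le_of_sq_le_sq' _ (abs_nonneg _) |>.2
    rw [sq_abs]
    nlinarith
  have h4 : (d : ℝ) * e ≤ 2 * D * (2 * D) := mul_le_mul hd' he' he0.le (by linarith)
  rw [div_sub_div _ _ hd0.ne' he0.ne', abs_div, abs_of_pos (mul_pos hd0 he0), ← mul_div_assoc,
    le_div_iff₀ (mul_pos hd0 he0), mul_comm (d : ℝ) (w : ℝ)]
  nlinarith

/-- Orthogonality of the additive characters modulo `M`. -/
lemma sum_exp_mul_conj_exp {M : ℕ} (hM : 0 < M) {m n : ℕ} (hm : m ∈ Finset.Icc 1 M)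
    (hn : n ∈ Finset.Icc 1 M) :
    ∑ j ∈ Finset.range M, Complex.exp (2 * Real.pi * Complex.I * (j * m / M)) *
      (starRingEnd ℂ) (Complex.exp (2 * Real.pi * Complex.I * (j * n / M))) =
      if m = n then (M : ℂ) else 0 := by
  have hM0 : (M : ℂ) ≠ 0 := by exact_mod_cast hM.ne'
  set w : ℂ := Complex.exp (2 * Real.pi * Complex.I * ((m - n) / M)) with hw
  have hterm : ∀ j ∈ Finset.range M, Complex.exp (2 * Real.pi * Complex.I * (j * m / M)) *
      (starRingEnd ℂ) (Complex.exp (2 * Real.pi * Complex.I * (j * n / M))) = w ^ j := by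
    intro j _
    rw [← Complex.exp_conj, ← Complex.exp_add, hw, ← Complex.exp_nat_mul]
    congr 1
    simp only [map_mul, map_div₀, map_natCast, Complex.conj_I, Complex.conj_ofReal, map_ofNat]
    ring
  rw [Finset.sum_congr rfl hterm]
  split_ifs with h
  · simp [hw, h]
  · have hw1 : w ≠ 1 := by
      intro h1
      obtain ⟨k, hk⟩ := Complex.exp_eq_one_iff.mp h1
      have h2 : ((m : ℂ) - n) / M = k := by
        apply mul_left_cancel₀ Complex.two_pi_I_ne_zero
        rw [hk]; ring
      rw [div_eq_iff hM0] at h2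
      have h3 : (m : ℤ) - n = k * M := by exact_mod_cast h2
      simp only [Finset.mem_Icc] at hm hn
      have h4 : (M : ℤ) ∣ (m : ℤ) - n := ⟨k, by rw [h3]; ring⟩
      have h5 := Int.eq_zero_of_abs_lt_dvd h4 (by rw [abs_lt]; omega)
      omega
    have hwM : w ^ M = 1 := by
      rw [hw, ← Complex.exp_nat_mul, Complex.exp_eq_one_iff]
      refine ⟨(m : ℤ) - n, ?_⟩
      push_cast
      field_simp
    have h := geom_sum_mul w M
    rw [hwM, sub_self] at h
    exact (mul_eq_zero.mp h).resolve_right (sub_ne_zero.mpr hw1)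

/-- Parseval's identity on the grid `j / M`. -/
lemma sum_norm_sq_exp_sum {M N : ℕ} (hM : 0 < M) (hNM : N ≤ M) (a : ℕ → ℂ) :
    ∑ j ∈ Finset.range M,
      ‖∑ n ∈ Finset.Icc 1 N, a n * Complex.exp (2 * Real.pi * Complex.I * (j * n / M))‖ ^ 2 =
      M * ∑ n ∈ Finset.Icc 1 N, ‖a n‖ ^ 2 := by
  have hsub : ∀ n ∈ Finset.Icc 1 N, n ∈ Finset.Icc 1 M := fun n hn ↦
    Finset.Icc_subset_Icc_right hNM hn
  apply Complex.ofReal_injective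
  push_cast
  simp_rw [← Complex.mul_conj', map_sum, map_mul, Finset.sum_mul_sum]
  rw [Finset.sum_comm, Finset.mul_sum]
  refine Finset.sum_congr rfl fun m hm ↦ ?_
  rw [Finset.sum_comm]
  have : ∀ n ∈ Finset.Icc 1 N, ∑ j ∈ Finset.range M,
      a m * Complex.exp (2 * Real.pi * Complex.I * (j * m / M)) *
        ((starRingEnd ℂ) (a n) *
          (starRingEnd ℂ) (Complex.exp (2 * Real.pi * Complex.I * (j * n / M)))) =
      if m = n then M * (a m * (starRingEnd ℂ) (a n)) else 0 := by
    intro n hn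
    have h := sum_exp_mul_conj_exp hM (hsub m hm) (hsub n hn)
    calc _ = a m * (starRingEnd ℂ) (a n) * ∑ j ∈ Finset.range M,
          Complex.exp (2 * Real.pi * Complex.I * (j * m / M)) *
          (starRingEnd ℂ) (Complex.exp (2 * Real.pi * Complex.I * (j * n / M))) := by
          rw [Finset.mul_sum]
          exact Finset.sum_congr rfl fun j _ ↦ by ring
      _ = _ := by rw [h]; split_ifs <;> ring
  rw [Finset.sum_congr rfl this, Finset.sum_ite_eq, if_pos hm]

/-- Mean value of an exponential sum over a set of distinct grid points. -/
lemma sum_norm_exp_sum_grid_le {ι : Type*} (R : Finset ι) {M N : ℕ} (hM : 0 < M) (hNM : N ≤ M)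
    (j : ι → ℕ) (hj : ∀ r ∈ R, j r < M) (hinj : Set.InjOn j R) (a : ℕ → ℂ) :
    ∑ r ∈ R,
      ‖∑ n ∈ Finset.Icc 1 N, a n * Complex.exp (2 * Real.pi * Complex.I * (j r * n / M))‖ ≤
      Real.sqrt (R.card * (M * ∑ n ∈ Finset.Icc 1 N, ‖a n‖ ^ 2)) := by
  classical
  apply Real.le_sqrt_of_sq_le
  refine sq_sum_le_card_mul_sum_sq.trans ?_
  gcongr
  rw [← sum_norm_sq_exp_sum hM hNM, ← Finset.sum_image (g := j)
    (f := fun j : ℕ ↦ ‖∑ n ∈ Finset.Icc 1 N,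
      a n * Complex.exp (2 * Real.pi * Complex.I * (j * n / M))‖ ^ 2) hinj]
  refine Finset.sum_le_sum_of_subset_of_nonneg ?_ fun _ _ _ ↦ by positivity
  intro i hi
  obtain ⟨r, hr, rfl⟩ := Finset.mem_image.mp hi
  exact Finset.mem_range.mpr (hj r hr)

/-- An `ℓ¹` large sieve inequality for points in distinct cells of the grid of mesh `1 / M`. -/
lemma sum_norm_exp_sum_le {ι : Type*} (R : Finset ι) {M N : ℕ} (hM : 0 < M) (hNM : N ≤ M)
    (x : ι → ℝ) (hx0 : ∀ r ∈ R, 0 ≤ x r) (hx1 : ∀ r ∈ R, x r < 1)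
    (hinj : Set.InjOn (fun r ↦ ⌊M * x r⌋₊) R) (a : ℕ → ℂ) :
    ∑ r ∈ R,
      ‖∑ n ∈ Finset.Icc 1 N, a n * Complex.exp (2 * Real.pi * Complex.I * (x r * n))‖ ≤
      Real.exp (2 * Real.pi) *
        Real.sqrt (R.card * (M * ∑ n ∈ Finset.Icc 1 N, ‖a n‖ ^ 2)) := by
  have hMR : (0 : ℝ) < M := by exact_mod_cast hM
  have hM0 : (M : ℂ) ≠ 0 := by exact_mod_cast hM.ne'
  set B := Real.sqrt (R.card * (M * ∑ n ∈ Finset.Icc 1 N, ‖a n‖ ^ 2)) with hB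
  set j : ι → ℕ := fun r ↦ ⌊M * x r⌋₊ with hjdef
  have hj : ∀ r ∈ R, j r < M := by
    intro r hr
    rw [hjdef, Nat.floor_lt (mul_nonneg hMR.le (hx0 r hr))]
    nlinarith [hx1 r hr]
  set t : ι → ℝ := fun r ↦ M * x r - j r with htdef
  have ht0 : ∀ r ∈ R, |t r| ≤ 1 := by
    intro r hr
    have h1 := Nat.floor_le (mul_nonneg hMR.le (hx0 r hr))
    have h2 := Nat.lt_floor_add_one (M * x r)
    rw [abs_le]
    constructor <;> simp only [htdef, hjdef] <;> linarith
  set b : ℕ → ℕ → ℂ := fun k n ↦ a n * ((n : ℂ) / M) ^ k with hb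
  set g : ι → ℕ → ℂ := fun r k ↦ (2 * Real.pi * Complex.I * t r) ^ k / (k.factorial : ℂ) *
    ∑ n ∈ Finset.Icc 1 N, b k n * Complex.exp (2 * Real.pi * Complex.I * (j r * n / M)) with hg
  have hsum : ∀ r, HasSum (g r)
      (∑ n ∈ Finset.Icc 1 N, a n * Complex.exp (2 * Real.pi * Complex.I * (x r * n))) := by
    intro r
    simp_rw [hg, Finset.mul_sum]
    refine hasSum_sum fun n _ ↦ ?_
    have h := (NormedSpace.expSeries_div_hasSum_exp
      (2 * Real.pi * Complex.I * t r * (n / M))).mul_left (a n * Complex.exp (2 * Real.pi * Complex.I * (j r * n / M)))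
    rw [← Complex.exp_eq_exp_ℂ, mul_assoc (a n), ← Complex.exp_add] at h
    have harg : 2 * Real.pi * Complex.I * (j r * n / M) +
        2 * Real.pi * Complex.I * t r * (n / M) = 2 * Real.pi * Complex.I * (x r * n) := by
      simp only [htdef]
      push_cast
      field_simp
      ring
    rw [harg] at h
    refine h.congr_fun fun k ↦ ?_
    simp only [hb, mul_pow]
    ring
  have hcoef : ∀ k, Real.sqrt (R.card * (M * ∑ n ∈ Finset.Icc 1 N, ‖b k n‖ ^ 2)) ≤ B := by
    intro k
    rw [hB]
    gcongr with n hn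
    have hn' : (n : ℝ) / M ≤ 1 := by
      rw [div_le_one hMR]
      exact_mod_cast (Finset.mem_Icc.mp hn).2.trans hNM
    simp only [hb, norm_mul, norm_pow, norm_div, Complex.norm_natCast]
    exact mul_le_of_le_one_right (norm_nonneg _) (pow_le_one₀ (by positivity) hn')
  have hk : ∀ k, ∑ r ∈ R, ‖g r k‖ ≤ (2 * Real.pi) ^ k / (k.factorial : ℝ) * B := by
    intro k
    refine le_trans ?_ (mul_le_mul_of_nonneg_left
      ((sum_norm_exp_sum_grid_le R hM hNM j hj hinj (b k)).trans (hcoef k)) (by positivity))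
    rw [Finset.mul_sum]
    refine Finset.sum_le_sum fun r hr ↦ ?_
    simp only [hg, norm_mul, norm_div, norm_pow, Complex.norm_natCast, Complex.norm_I,
      Complex.norm_real, Complex.norm_ofNat, mul_one, Real.norm_eq_abs, abs_of_pos Real.pi_pos]
    refine mul_le_mul_of_nonneg_right ?_ (norm_nonneg _)
    refine div_le_div_of_nonneg_right (pow_le_pow_left₀ (by positivity) ?_ k) (by positivity)
    exact mul_le_of_le_one_right (by positivity) (ht0 r hr)
  refine le_of_tendsto (tendsto_finsetSum R fun r _ ↦ (hsum r).tendsto_sum_nat.norm)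
    (Filter.Eventually.of_forall fun K ↦ ?_)
  calc ∑ r ∈ R, ‖∑ k ∈ Finset.range K, g r k‖
      ≤ ∑ r ∈ R, ∑ k ∈ Finset.range K, ‖g r k‖ := Finset.sum_le_sum fun r _ ↦ norm_sum_le _ _
    _ = ∑ k ∈ Finset.range K, ∑ r ∈ R, ‖g r k‖ := Finset.sum_comm
    _ ≤ ∑ k ∈ Finset.range K, (2 * Real.pi) ^ k / (k.factorial : ℝ) * B :=
        Finset.sum_le_sum fun k _ ↦ hk k
    _ = (∑ k ∈ Finset.range K, (2 * Real.pi) ^ k / (k.factorial : ℝ)) * B := by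
        rw [Finset.sum_mul]
    _ ≤ Real.exp (2 * Real.pi) * B := by
        gcongr
        exact Real.sum_le_exp_of_nonneg (by positivity) K

/-- The large sieve for fractions `v / d`, `d ∣ v² + 3`, with the moduli in a short interval. -/
lemma sum_norm_exp_sum_roots_le {D : ℝ} (hD : 1 ≤ D) (N : ℕ) (a : ℕ → ℂ)
    (R : Finset (Σ _ : ℕ, ℕ))
    (hmod : ∀ p ∈ R, D < (p.1 : ℝ) ∧ (p.1 : ℝ) ≤ 2 * D)
    (hroot : ∀ p ∈ R, p.2 < p.1 ∧ p.1 ∣ p.2 ^ 2 + 3)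
    (hshort : ∀ p ∈ R, ∀ q ∈ R, |(p.1 : ℝ) - q.1| ≤ D / 2) :
    ∑ p ∈ R, ‖∑ n ∈ Finset.Icc 1 N,
        a n * Complex.exp (2 * Real.pi * Complex.I * ((p.2 : ℂ) * n / p.1))‖ ≤
      9 * Real.exp (2 * Real.pi) * (Real.sqrt D * Real.sqrt (D + N) *
        Real.sqrt (∑ n ∈ Finset.Icc 1 N, ‖a n‖ ^ 2)) := by
  have hD0 : 0 < D := by linarith
  set x : (Σ _ : ℕ, ℕ) → ℝ := fun p ↦ (p.2 : ℝ) / p.1 with hx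
  have hx0 : ∀ p ∈ R, 0 ≤ x p := fun p _ ↦ by positivity
  have hx1 : ∀ p ∈ R, x p < 1 := by
    intro p hp
    rw [hx, div_lt_one (hD0.trans (hmod p hp).1)]
    exact_mod_cast (hroot p hp).1
  have hinj : ∀ M : ℕ, 8 * D ≤ M → Set.InjOn (fun p ↦ ⌊M * x p⌋₊) R := by
    intro M hM p hp q hq hpq
    by_contra hne
    have hsep : 1 ≤ 8 * D * |x p - x q| :=
      one_le_abs_div_sub_div hD0 (hmod p hp).1 (hmod p hp).2 (hmod q hq).1 (hmod q hq).2
        (hshort p hp q hq) (hroot p hp).2 (hroot q hq).2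
        (fun h ↦ hne (Sigma.ext h.1 (heq_of_eq h.2)))
    have hM0 : (0 : ℝ) ≤ M := by positivity
    have hclose : |M * x p - M * x q| < 1 := by
      have h1 := Nat.floor_le (mul_nonneg hM0 (hx0 p hp))
      have h2 := Nat.lt_floor_add_one (M * x p)
      have h3 := Nat.floor_le (mul_nonneg hM0 (hx0 q hq))
      have h4 := Nat.lt_floor_add_one (M * x q)
      simp only at hpq
      rw [hpq] at h1 h2
      rw [abs_lt]
      constructor <;> linarith
    rw [← mul_sub, abs_mul, abs_of_nonneg hM0] at hclose
    nlinarith [mul_le_mul_of_nonneg_right hM (abs_nonneg (x p - x q))]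
  set L := ⌈8 * D⌉₊ with hL
  have hL1 : 8 * D ≤ L := Nat.le_ceil _
  have hL2 : (L : ℝ) ≤ 9 * D := by linarith [Nat.ceil_lt_add_one (a := 8 * D) (by positivity)]
  have hL0 : 0 < L := Nat.ceil_pos.mpr (by positivity)
  have hLR : (0 : ℝ) < L := by exact_mod_cast hL0
  have hcard : (R.card : ℝ) ≤ 9 * D := by
    refine le_trans ?_ hL2
    have := Finset.card_le_card_of_injOn (t := Finset.range L) _ (fun p hp ↦ by
      simp only [Finset.coe_range, Set.mem_Iio]
      rw [Nat.floor_lt (mul_nonneg hLR.le (hx0 p hp))]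
      nlinarith [hx1 p hp]) (hinj L hL1)
    rw [Finset.card_range] at this
    exact_mod_cast this
  have h := sum_norm_exp_sum_le R (M := L + N) (N := N) (by omega) (by omega) x hx0 hx1
    (hinj (L + N) (by push_cast; linarith [Nat.cast_nonneg (α := ℝ) N])) a
  calc _ = ∑ p ∈ R, ‖∑ n ∈ Finset.Icc 1 N,
        a n * Complex.exp (2 * Real.pi * Complex.I * (x p * n))‖ := by
        refine Finset.sum_congr rfl fun p _ ↦ ?_
        congr 1
        refine Finset.sum_congr rfl fun n _ ↦ ?_
        simp only [hx]
        push_cast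
        ring_nf
    _ ≤ _ := h
    _ ≤ Real.exp (2 * Real.pi) *
        Real.sqrt (9 * D * (9 * (D + N) * ∑ n ∈ Finset.Icc 1 N, ‖a n‖ ^ 2)) := by
        gcongr
        push_cast
        linarith [Nat.cast_nonneg (α := ℝ) N]
    _ = _ := by
        rw [show 9 * D * (9 * (D + N) * ∑ n ∈ Finset.Icc 1 N, ‖a n‖ ^ 2) =
          9 ^ 2 * (D * (D + N) * ∑ n ∈ Finset.Icc 1 N, ‖a n‖ ^ 2) by ring,
          Real.sqrt_mul (by positivity), Real.sqrt_sq (by norm_num),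
          Real.sqrt_mul (by positivity), Real.sqrt_mul hD0.le]
        ring


/-- Cauchy–Schwarz consequence of the large sieve for roots of `v² + 3 ≡ 0 (mod d)`:
`∑_{D < d ≤ 2D, d odd} ∑_{v² + 3 ≡ 0 (d)} |∑_{n ≤ N} αₙ e(vn/d)|
  ≤ C D^{1/2} (D + N)^{1/2} (∑ |αₙ|²)^{1/2}`. -/
theorem large_sieve_abs :
    ∃ C : ℝ, ∀ D : ℝ, 1 ≤ D → ∀ N : ℕ, 0 < N → ∀ α : ℕ → ℂ,
      ∑ d ∈ (Finset.Icc 1 (Nat.floor (2 * D))).filter (fun d : ℕ => D < (d : ℝ) ∧ Odd d),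
        ∑ v ∈ (Finset.range d).filter (fun v => d ∣ v ^ 2 + 3),
          ‖∑ n ∈ Finset.Icc 1 N,
              α n * Complex.exp (2 * Real.pi * Complex.I * ((v : ℂ) * n / d))‖
        ≤ C * Real.sqrt D * Real.sqrt (D + N) *
            Real.sqrt (∑ n ∈ Finset.Icc 1 N, ‖α n‖ ^ 2) := by
  refine ⟨18 * Real.exp (2 * Real.pi), fun D hD N _ α ↦ ?_⟩
  rw [Finset.sum_sigma']
  set R := ((Finset.Icc 1 (Nat.floor (2 * D))).filter (fun d : ℕ => D < (d : ℝ) ∧ Odd d)).sigma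
    fun d ↦ (Finset.range d).filter (fun v => d ∣ v ^ 2 + 3) with hR
  have hmem : ∀ p ∈ R, (D < (p.1 : ℝ) ∧ (p.1 : ℝ) ≤ 2 * D) ∧ p.2 < p.1 ∧ p.1 ∣ p.2 ^ 2 + 3 := by
    intro p hp
    simp only [hR, Finset.mem_sigma, Finset.mem_filter, Finset.mem_Icc, Finset.mem_range] at hp
    exact ⟨⟨hp.1.2.1, (Nat.le_floor_iff (by linarith)).mp hp.1.1.2⟩, hp.2⟩
  rw [← Finset.sum_filter_add_sum_filter_not R (fun p ↦ (p.1 : ℝ) ≤ 3 / 2 * D)]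
  have h₁ := sum_norm_exp_sum_roots_le hD N α (R.filter fun p ↦ (p.1 : ℝ) ≤ 3 / 2 * D)
    (fun p hp ↦ (hmem p (Finset.mem_filter.mp hp).1).1)
    (fun p hp ↦ (hmem p (Finset.mem_filter.mp hp).1).2) (by
      intro p hp q hq
      rw [Finset.mem_filter] at hp hq
      have := (hmem p hp.1).1
      have := (hmem q hq.1).1
      rw [abs_le]
      constructor <;> linarith)
  have h₂ := sum_norm_exp_sum_roots_le hD N α (R.filter fun p ↦ ¬ (p.1 : ℝ) ≤ 3 / 2 * D)
    (fun p hp ↦ (hmem p (Finset.mem_filter.mp hp).1).1)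
    (fun p hp ↦ (hmem p (Finset.mem_filter.mp hp).1).2) (by
      intro p hp q hq
      rw [Finset.mem_filter, not_le] at hp hq
      have := (hmem p hp.1).1
      have := (hmem q hq.1).1
      rw [abs_le]
      constructor <;> linarith)
  linarith
end

section
/- For every ε > 0 there is a constant C = C(ε) such that for all real x ≥ 2 and all real D with 1 ≤ D ≤ x: ∑_{d ≤ D} |A_d(x) − A_d^*(x)| ≤ C x^{1/2 + ε}. -/
open Classical

/-- `γ_ℓ = log ℓ` if `ℓ` is a prime greater than `2`, and `0` otherwise. -/
noncomputable def gam : ℤ → ℝ := fun ℓ => if 2 < ℓ ∧ Prime ℓ then Real.log ℓ else 0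

/-- `A_d(x) = ∑_{(r,s) : (r² + 3s²)/4 ≤ x, 4d ∣ r² + 3s²} γ_r`. -/
noncomputable def AdSum (d : ℕ) (x : ℝ) : ℝ :=
  ∑ᶠ p : ℤ × ℤ,
    if ((p.1 ^ 2 + 3 * p.2 ^ 2 : ℤ) : ℝ) ≤ 4 * x ∧ (4 * (d : ℤ)) ∣ p.1 ^ 2 + 3 * p.2 ^ 2
    then gam p.1 else 0

/-- `A_d^*(x)`: the same sum restricted to `gcd(r, d) = 1`. -/
noncomputable def AdSumStar (d : ℕ) (x : ℝ) : ℝ :=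
  ∑ᶠ p : ℤ × ℤ,
    if ((p.1 ^ 2 + 3 * p.2 ^ 2 : ℤ) : ℝ) ≤ 4 * x ∧ (4 * (d : ℤ)) ∣ p.1 ^ 2 + 3 * p.2 ^ 2 ∧
        Int.gcd p.1 (d : ℤ) = 1
    then gam p.1 else 0

/-- The divisor bound: the number of divisors of `n` is `O(n ^ ε)` for every `ε > 0`. -/
theorem exists_card_divisors_le_mul_rpow {ε : ℝ} (hε : 0 < ε) :
    ∃ C : ℝ, 1 ≤ C ∧ ∀ n : ℕ, n ≠ 0 → (n.divisors.card : ℝ) ≤ C * (n : ℝ) ^ ε := by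
  have hlog2 : 0 < Real.log 2 := Real.log_pos one_lt_two
  set c : ℝ := min 1 (ε * Real.log 2)
  have hc0 : 0 < c := lt_min one_pos (mul_pos hε hlog2)
  have hK : 1 ≤ c⁻¹ := (one_le_inv₀ hc0).2 (min_le_left _ _)
  set N : ℕ := ⌈(2 : ℝ) ^ ε⁻¹⌉₊
  refine ⟨c⁻¹ ^ N, one_le_pow₀ hK, fun n hn => ?_⟩
  have hlocal : ∀ p ∈ n.primeFactors, ((n.factorization p : ℝ) + 1) ≤
      (if p < N then c⁻¹ else 1) * ((p : ℝ) ^ n.factorization p) ^ ε := by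
    intro p hp
    have hp2 : (2 : ℝ) ≤ p := by exact_mod_cast (Nat.prime_of_mem_primeFactors hp).two_le
    have hp0 : (0 : ℝ) ≤ p := by linarith
    set a := n.factorization p
    have hcomm : ((p : ℝ) ^ a) ^ ε = ((p : ℝ) ^ ε) ^ a := by
      rw [← Real.rpow_natCast, ← Real.rpow_mul hp0, mul_comm, Real.rpow_mul hp0,
        Real.rpow_natCast]
    rw [hcomm]
    split_ifs with h
    · have h1 : (2 : ℝ) ^ ε ≤ (p : ℝ) ^ ε := Real.rpow_le_rpow two_pos.le hp2 hε.le
      have h2 : 1 + ε * Real.log 2 ≤ (2 : ℝ) ^ ε := by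
        rw [Real.rpow_def_of_pos two_pos]
        linarith [Real.add_one_le_exp (Real.log 2 * ε)]
      have h3 : 1 + c ≤ (p : ℝ) ^ ε := by linarith [min_le_right 1 (ε * Real.log 2)]
      have h4 : 1 + a * c ≤ ((p : ℝ) ^ ε) ^ a :=
        (one_add_mul_le_pow (by linarith) a).trans (pow_le_pow_left₀ (by linarith) h3 a)
      calc (a : ℝ) + 1 ≤ c⁻¹ * (1 + a * c) := by
            rw [mul_add, mul_left_comm, inv_mul_cancel₀ hc0.ne']; linarith
        _ ≤ _ := by gcongr
    · have h1 : (2 : ℝ) ^ ε⁻¹ ≤ p := (Nat.le_ceil _).trans (by exact_mod_cast not_lt.1 h)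
      have h2 : (2 : ℝ) ≤ (p : ℝ) ^ ε := by
        have := Real.rpow_le_rpow (by positivity) h1 hε.le
        rwa [← Real.rpow_mul two_pos.le, inv_mul_cancel₀ hε.ne', Real.rpow_one] at this
      rw [one_mul]
      calc (a : ℝ) + 1 ≤ 2 ^ a := by exact_mod_cast Nat.lt_two_pow_self
        _ ≤ _ := pow_le_pow_left₀ two_pos.le h2 a
  have hprod : ∏ p ∈ n.primeFactors, (if p < N then c⁻¹ else 1) ≤ c⁻¹ ^ N := by
    rw [← Finset.prod_filter, Finset.prod_const]
    refine pow_le_pow_right₀ hK ?_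
    calc _ ≤ (Finset.range N).card :=
          Finset.card_le_card fun p hp => Finset.mem_range.2 (Finset.mem_filter.1 hp).2
      _ = N := Finset.card_range N
  have hself : ∏ p ∈ n.primeFactors, ((p : ℝ) ^ n.factorization p) ^ ε = (n : ℝ) ^ ε := by
    rw [Real.finsetProd_rpow _ _ fun p _ => by positivity]
    congr 1
    exact_mod_cast Nat.prod_factorization_pow_eq_self hn
  rw [Nat.card_divisors hn]
  push_cast
  calc _ ≤ ∏ p ∈ n.primeFactors,
        (if p < N then c⁻¹ else 1) * ((p : ℝ) ^ n.factorization p) ^ ε :=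
        Finset.prod_le_prod (fun p _ => by positivity) hlocal
    _ ≤ _ := by
        rw [Finset.prod_mul_distrib, hself]
        gcongr

theorem gam_nonneg (l : ℤ) : 0 ≤ gam l := by
  unfold gam
  split_ifs with h
  · exact Real.log_nonneg (by exact_mod_cast (show (1 : ℤ) ≤ l by omega))
  · rfl

/-- A box containing every pair that contributes to `AdSum` when `M ^ 2` is about `4 * x`. -/
noncomputable def pairBox (M : ℕ) : Finset (ℤ × ℤ) :=
  Finset.Icc (1 : ℤ) M ×ˢ Finset.Icc (-M : ℤ) M

theorem abs_le_floor_sqrt {X : ℝ} {a b : ℤ} (h : ((a ^ 2 + b : ℤ) : ℝ) ≤ X) (hb : 0 ≤ b) :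
    |a| ≤ (⌊√X⌋₊ : ℤ) := by
  have h1 : ((a.natAbs : ℕ) : ℝ) ≤ √X := by
    apply Real.le_sqrt_of_sq_le
    have : ((a.natAbs : ℤ) : ℝ) ^ 2 = (a : ℝ) ^ 2 := by rw [Int.natCast_natAbs]; simp
    have hb' : (0 : ℝ) ≤ b := by exact_mod_cast hb
    push_cast at h
    rw [Int.cast_natCast] at this
    linarith
  have h2 := Nat.le_floor h1
  rw [← Int.natCast_natAbs]
  exact_mod_cast h2

theorem finsum_gam_eq_sum_pairBox {x : ℝ} (Q : ℤ × ℤ → Prop) [DecidablePred Q]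
    (hQ : ∀ p, Q p → ((p.1 ^ 2 + 3 * p.2 ^ 2 : ℤ) : ℝ) ≤ 4 * x) :
    (∑ᶠ p : ℤ × ℤ, if Q p then gam p.1 else 0) =
      ∑ p ∈ pairBox ⌊√(4 * x)⌋₊, if Q p then gam p.1 else 0 := by
  refine finsum_eq_sum_of_support_subset _ fun p hp => ?_
  rw [Function.mem_support] at hp
  have h1 : Q p := by_contra fun h => hp (if_neg h)
  rw [if_pos h1] at hp
  have h2 : 2 < p.1 := by
    by_contra h
    exact hp (if_neg fun h' => h h'.1)
  have h3 := abs_le_floor_sqrt (hQ p h1) (by positivity)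
  have h4 : |p.2| ≤ (⌊√(4 * x)⌋₊ : ℤ) := by
    refine abs_le_floor_sqrt (b := p.1 ^ 2 + 2 * p.2 ^ 2) ?_ (by positivity)
    convert hQ p h1 using 2
    ring
  rw [abs_le] at h3 h4
  simp only [pairBox, Finset.coe_product, Set.mem_prod, Finset.coe_Icc, Set.mem_Icc]
  omega

theorem AdSum_sub_AdSumStar (d : ℕ) (x : ℝ) :
    AdSum d x - AdSumStar d x = ∑ p ∈ pairBox ⌊√(4 * x)⌋₊,
      if ((p.1 ^ 2 + 3 * p.2 ^ 2 : ℤ) : ℝ) ≤ 4 * x ∧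
        (4 * (d : ℤ)) ∣ p.1 ^ 2 + 3 * p.2 ^ 2 ∧ Int.gcd p.1 (d : ℤ) ≠ 1
      then gam p.1 else 0 := by
  have h1 : AdSum d x = _ := finsum_gam_eq_sum_pairBox (x := x)
    (fun p : ℤ × ℤ => ((p.1 ^ 2 + 3 * p.2 ^ 2 : ℤ) : ℝ) ≤ 4 * x ∧
      (4 * (d : ℤ)) ∣ p.1 ^ 2 + 3 * p.2 ^ 2) fun p hp => hp.1
  have h2 : AdSumStar d x = _ := finsum_gam_eq_sum_pairBox (x := x)
    (fun p : ℤ × ℤ => ((p.1 ^ 2 + 3 * p.2 ^ 2 : ℤ) : ℝ) ≤ 4 * x ∧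
      (4 * (d : ℤ)) ∣ p.1 ^ 2 + 3 * p.2 ^ 2 ∧ Int.gcd p.1 (d : ℤ) = 1) fun p hp => hp.1
  rw [h1, h2, ← Finset.sum_sub_distrib]
  refine Finset.sum_congr rfl fun p _ => ?_
  by_cases hg : Int.gcd p.1 (d : ℤ) = 1 <;> simp [hg]

theorem eq_three_or_dvd_of_gcd_ne_one {l s : ℤ} {d : ℕ} (hl : 2 < l) (hp : Prime l)
    (hd : 4 * (d : ℤ) ∣ l ^ 2 + 3 * s ^ 2) (hg : Int.gcd l d ≠ 1) : l = 3 ∨ l ∣ s := by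
  have hld : l ∣ d := by
    by_contra h
    exact hg (Int.isCoprime_iff_gcd_eq_one.1 ((hp.irreducible.coprime_iff_not_dvd).2 h))
  have h1 : l ∣ 3 * s ^ 2 :=
    (dvd_add_right (dvd_pow_self l two_ne_zero)).1 ((hld.mul_left 4).trans hd)
  rcases hp.dvd_or_dvd h1 with h | h
  · left
    have := Int.le_of_dvd (by norm_num) h
    omega
  · exact Or.inr (hp.dvd_of_dvd_pow h)

theorem sum_gam_not_coprime_le {X T : ℝ} (hT : 0 ≤ T) (hX : 1 ≤ X)
    (hdiv : ∀ n : ℕ, n ≠ 0 → (n : ℝ) ≤ X → (n.divisors.card : ℝ) ≤ T) (N : ℕ) (p : ℤ × ℤ) :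
    ∑ d ∈ Finset.Icc 1 N, (if ((p.1 ^ 2 + 3 * p.2 ^ 2 : ℤ) : ℝ) ≤ X ∧
        (4 * (d : ℤ)) ∣ p.1 ^ 2 + 3 * p.2 ^ 2 ∧ Int.gcd p.1 (d : ℤ) ≠ 1
      then gam p.1 else 0) ≤ if p.1 = 3 ∨ p.1 ∣ p.2 then T * Real.log X else 0 := by
  obtain ⟨l, s⟩ := p
  have hrhs : 0 ≤ if l = 3 ∨ l ∣ s then T * Real.log X else 0 := by
    have := Real.log_nonneg hX
    split_ifs <;> positivity
  by_cases hl : 2 < l ∧ Prime l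
  swap
  · simpa [gam, hl] using hrhs
  by_cases hn : ((l ^ 2 + 3 * s ^ 2 : ℤ) : ℝ) ≤ X
  swap
  · simp only [hn, false_and, if_false, Finset.sum_const_zero]
    exact hrhs
  split_ifs with h
  swap
  · refine (Finset.sum_eq_zero fun d _ => if_neg ?_).le
    rintro ⟨-, h1, h2⟩
    exact h (eq_three_or_dvd_of_gcd_ne_one hl.1 hl.2 h1 h2)
  have hl0 : (2 : ℝ) < l := by exact_mod_cast hl.1
  have hpos : 0 < l ^ 2 + 3 * s ^ 2 := by nlinarith [sq_nonneg s]
  obtain ⟨m, hm⟩ := Int.eq_ofNat_of_zero_le hpos.le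
  have hm0 : m ≠ 0 := by rintro rfl; simp at hm; omega
  have hcard : ((m.divisors.card : ℕ) : ℝ) ≤ T := by
    refine hdiv m hm0 ?_
    rw [hm] at hn
    exact_mod_cast hn
  have hlX : (l : ℝ) ≤ X := by
    push_cast at hn
    nlinarith [sq_nonneg (s : ℝ)]
  calc _ ≤ ∑ d ∈ Finset.Icc 1 N, (if d ∈ m.divisors then gam l else 0) := by
        refine Finset.sum_le_sum fun d _ => ?_
        have := gam_nonneg l
        by_cases hd : d ∈ m.divisors
        · rw [if_pos hd]
          split_ifs <;> simp [this]
        · rw [if_neg hd, if_neg]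
          rintro ⟨-, h1, -⟩
          refine hd (Nat.mem_divisors.2 ⟨?_, hm0⟩)
          have h1' : 4 * (d : ℤ) ∣ l ^ 2 + 3 * s ^ 2 := h1
          rw [hm] at h1'
          exact_mod_cast (Dvd.intro_left _ rfl).trans h1'
    _ = ((Finset.Icc 1 N).filter (· ∈ m.divisors)).card * gam l := by
        rw [← Finset.sum_filter, Finset.sum_const, nsmul_eq_mul]
    _ ≤ m.divisors.card * gam l := by
        have := gam_nonneg l
        have : ((Finset.Icc 1 N).filter (· ∈ m.divisors)).card ≤ m.divisors.card :=
          Finset.card_le_card fun d hd => (Finset.mem_filter.1 hd).2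
        gcongr
    _ ≤ T * Real.log X := by
        rw [gam, if_pos hl]
        exact mul_le_mul hcard (Real.log_le_log (by linarith) hlX)
          (Real.log_nonneg (by linarith)) hT

theorem card_pairBox_filter_le {T : ℝ} {M : ℕ} (hM : 1 ≤ M) (hT : 1 ≤ T)
    (hdiv : ∀ n : ℕ, n ≠ 0 → n ≤ M → (n.divisors.card : ℝ) ≤ T) :
    (((pairBox M).filter fun p => p.1 = 3 ∨ p.1 ∣ p.2).card : ℝ) ≤ 7 * M * T := by
  have hfiber : ∀ s ∈ Finset.Icc (-M : ℤ) M,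
      ((((Finset.Icc (1 : ℤ) M).filter fun r => r = 3 ∨ r ∣ s).card : ℕ) : ℝ) ≤
        1 + T + if s = 0 then (M : ℝ) else 0 := by
    intro s hs
    have h3 : ((Finset.Icc (1 : ℤ) M).filter fun r => r = 3).card ≤ 1 := by
      refine Finset.card_le_one.2 fun a ha b hb => ?_
      rw [(Finset.mem_filter.1 ha).2, (Finset.mem_filter.1 hb).2]
    have hds : (((Finset.Icc (1 : ℤ) M).filter fun r => r ∣ s).card : ℝ) ≤
        T + if s = 0 then (M : ℝ) else 0 := by
      split_ifs with h
      · have : (((Finset.Icc (1 : ℤ) M).filter fun r => r ∣ s).card : ℝ) ≤ M := by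
          exact_mod_cast (Finset.card_filter_le _ _).trans (by simp)
        linarith
      · rw [add_zero]
        refine le_trans ?_ (hdiv s.natAbs (by simpa using h) ?_)
        · norm_cast
          refine Finset.card_le_card_of_injOn Int.natAbs ?_ ?_
          · intro r hr
            have hr' := (Finset.mem_filter.1 hr).2
            simpa [h] using Int.natAbs_dvd_natAbs.2 hr'
          · intro a ha b hb hab
            have ha' := (Finset.mem_Icc.1 (Finset.mem_filter.1 ha).1).1
            have hb' := (Finset.mem_Icc.1 (Finset.mem_filter.1 hb).1).1
            omega
        · rw [Finset.mem_Icc] at hs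
          omega
    have hle : ((Finset.Icc (1 : ℤ) M).filter fun r => r = 3 ∨ r ∣ s).card ≤
        ((Finset.Icc (1 : ℤ) M).filter fun r => r = 3).card +
          ((Finset.Icc (1 : ℤ) M).filter fun r => r ∣ s).card := by
      rw [Finset.filter_or]
      exact Finset.card_union_le _ _
    have hle' : (((Finset.Icc (1 : ℤ) M).filter fun r => r = 3 ∨ r ∣ s).card : ℝ) ≤
        1 + ((Finset.Icc (1 : ℤ) M).filter fun r => r ∣ s).card := by
      exact_mod_cast hle.trans (by gcongr)
    linarith
  have hM' : (1 : ℝ) ≤ M := by exact_mod_cast hM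
  calc (((pairBox M).filter fun p => p.1 = 3 ∨ p.1 ∣ p.2).card : ℝ)
      = ∑ s ∈ Finset.Icc (-M : ℤ) M,
          ((((Finset.Icc (1 : ℤ) M).filter fun r => r = 3 ∨ r ∣ s).card : ℕ) : ℝ) := by
        rw [Finset.card_filter, pairBox, Finset.sum_product_right]
        push_cast
        refine Finset.sum_congr rfl fun s _ => ?_
        rw [Finset.card_filter]
        push_cast
        rfl
    _ ≤ ∑ s ∈ Finset.Icc (-M : ℤ) M, (1 + T + if s = 0 then (M : ℝ) else 0) :=
        Finset.sum_le_sum hfiber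
    _ = (2 * M + 1) * (1 + T) + M := by
        rw [Finset.sum_add_distrib, Finset.sum_const, Finset.sum_ite_eq', if_pos (by simp),
          Int.card_Icc, nsmul_eq_mul, show ((M : ℤ) + 1 - -M).toNat = 2 * M + 1 by omega]
        push_cast
        ring
    _ ≤ 7 * M * T := by nlinarith

/-- For every `ε > 0` there is `C` with
`∑_{d ≤ D} |A_d(x) − A_d^*(x)| ≤ C x^{1/2 + ε}` for all `2 ≤ x` and `1 ≤ D ≤ x`. -/
theorem coprimality_restriction_cost :
    ∀ ε : ℝ, 0 < ε → ∃ C : ℝ, ∀ x : ℝ, 2 ≤ x → ∀ D : ℝ, 1 ≤ D → D ≤ x →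
      ∑ d ∈ Finset.Icc 1 (Nat.floor D), |AdSum d x - AdSumStar d x|
        ≤ C * x ^ ((1 : ℝ) / 2 + ε) := by
  intro ε hε
  have hδ : 0 < ε / 3 := by positivity
  set δ := ε / 3 with hδdef
  obtain ⟨C, hC, hdivisors⟩ := exists_card_divisors_le_mul_rpow hδ
  refine ⟨7 * C ^ 2 / δ * 4 ^ ((1 : ℝ) / 2 + ε), fun x hx D _ _ => ?_⟩
  set X := 4 * x with hXdef
  have hX : 1 ≤ X := by linarith
  set T := C * X ^ δ with hTdef
  have hT : 1 ≤ T := one_le_mul_of_one_le_of_one_le hC (Real.one_le_rpow hX hδ.le)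
  have hdiv : ∀ n : ℕ, n ≠ 0 → (n : ℝ) ≤ X → (n.divisors.card : ℝ) ≤ T := fun n hn hnX =>
    (hdivisors n hn).trans (by rw [hTdef]; gcongr)
  set M := ⌊√X⌋₊
  have hsqrt : 1 ≤ √X := Real.one_le_sqrt.2 hX
  have hM : 1 ≤ M := Nat.le_floor (by exact_mod_cast hsqrt)
  have hMle : (M : ℝ) ≤ √X := Nat.floor_le (Real.sqrt_nonneg X)
  have hsqrtX : √X ≤ X := by nlinarith [Real.sq_sqrt (show 0 ≤ X by linarith)]
  have hcount := card_pairBox_filter_le hM hT fun n hn hnM =>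
    hdiv n hn ((Nat.cast_le.2 hnM).trans (hMle.trans hsqrtX))
  have hlog : Real.log X ≤ X ^ δ / δ := Real.log_le_rpow_div (by linarith) hδ
  have hlog0 : 0 ≤ Real.log X := Real.log_nonneg hX
  calc ∑ d ∈ Finset.Icc 1 ⌊D⌋₊, |AdSum d x - AdSumStar d x|
      = ∑ p ∈ pairBox M, ∑ d ∈ Finset.Icc 1 ⌊D⌋₊,
          (if ((p.1 ^ 2 + 3 * p.2 ^ 2 : ℤ) : ℝ) ≤ X ∧
            (4 * (d : ℤ)) ∣ p.1 ^ 2 + 3 * p.2 ^ 2 ∧ Int.gcd p.1 (d : ℤ) ≠ 1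
          then gam p.1 else 0) := by
        rw [Finset.sum_comm]
        refine Finset.sum_congr rfl fun d _ => ?_
        rw [AdSum_sub_AdSumStar, abs_of_nonneg]
        refine Finset.sum_nonneg fun p _ => ?_
        have := gam_nonneg p.1
        split_ifs <;> simp [this]
    _ ≤ ∑ p ∈ pairBox M, (if p.1 = 3 ∨ p.1 ∣ p.2 then T * Real.log X else 0) :=
        Finset.sum_le_sum fun p _ => sum_gam_not_coprime_le (by linarith) hX hdiv _ p
    _ = ((pairBox M).filter fun p => p.1 = 3 ∨ p.1 ∣ p.2).card * (T * Real.log X) := by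
        rw [← Finset.sum_filter, Finset.sum_const, nsmul_eq_mul]
    _ ≤ (7 * √X * T) * (T * (X ^ δ / δ)) := by
        have := hcount.trans (show 7 * (M : ℝ) * T ≤ 7 * √X * T by gcongr)
        gcongr
    _ = 7 * C ^ 2 / δ * X ^ ((1 : ℝ) / 2 + ε) := by
        have hε3 : (1 : ℝ) / 2 + ε = 1 / 2 + δ + δ + δ := by rw [hδdef]; ring
        have hX0 : 0 < X := by linarith
        rw [hε3, Real.rpow_add hX0, Real.rpow_add hX0, Real.rpow_add hX0, hTdef,
          Real.sqrt_eq_rpow]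
        ring
    _ = 7 * C ^ 2 / δ * 4 ^ ((1 : ℝ) / 2 + ε) * x ^ ((1 : ℝ) / 2 + ε) := by
        rw [hXdef, Real.mul_rpow (by norm_num) (by linarith), mul_assoc]
end

section
/- For every ε > 0 there is a constant C = C(ε) such that for all real M ≥ 1, the number of quadruples (a, b, c, d) ∈ ℤ⁴ satisfying M < a² − ab + b² ≤ 2M, M < c² − cd + d² ≤ 2M, and a·d = b·c, is at most C M^{1 + ε}. -/
open Finset in
/-- The multiples `(g x, g y, h x, h y)` of the points `(x, y)` of sup norm `m`, for `|g|, |h| ≤ N / m`. -/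
noncomputable def proportionalQuadruples (N m : ℕ) : Finset (ℤ × ℤ × ℤ × ℤ) :=
  ((box m : Finset (ℤ × ℤ)) ×ˢ
      (Icc (-((N / m : ℕ) : ℤ)) (N / m : ℕ) ×ˢ Icc (-((N / m : ℕ) : ℤ)) (N / m : ℕ))).image
    fun t => (t.2.1 * t.1.1, t.2.1 * t.1.2, t.2.2 * t.1.1, t.2.2 * t.1.2)

open Finset in
lemma card_proportionalQuadruples_le {N m : ℕ} (hm : 1 ≤ m) (hmN : m ≤ N) :
    ((proportionalQuadruples N m).card : ℝ) ≤ 72 * (N : ℝ) ^ 2 * (m : ℝ)⁻¹ := by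
  have hK : 1 ≤ N / m := (Nat.one_le_div_iff hm).2 hmN
  have hcard : (Icc (-((N / m : ℕ) : ℤ)) (N / m : ℕ)).card ≤ 3 * (N / m) := by
    rw [Int.card_Icc]
    omega
  have hle : (proportionalQuadruples N m).card ≤ 8 * m * (3 * (N / m) * (3 * (N / m))) := by
    refine card_image_le.trans ?_
    rw [card_product, card_product, Int.card_box (by omega)]
    gcongr
  have hm0 : (0 : ℝ) < m := by exact_mod_cast hm
  have hdiv : ((N / m : ℕ) : ℝ) ≤ N / m := Nat.cast_div_le
  calc ((proportionalQuadruples N m).card : ℝ)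
      ≤ 8 * m * (3 * (N / m : ℕ) * (3 * (N / m : ℕ))) := by exact_mod_cast hle
    _ ≤ 8 * m * (3 * (N / m) * (3 * (N / m))) := by gcongr
    _ = 72 * (N : ℝ) ^ 2 * (m : ℝ)⁻¹ := by field_simp; ring

lemma Int.exists_common_factor_of_mul_eq_mul {a b c d : ℤ} (h0 : a ≠ 0 ∨ b ≠ 0)
    (h : a * d = b * c) :
    ∃ x y g k : ℤ, (x ≠ 0 ∨ y ≠ 0) ∧ g ≠ 0 ∧
      a = g * x ∧ b = g * y ∧ c = k * x ∧ d = k * y := by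
  have hg : 0 < Int.gcd a b := Int.gcd_pos_iff.2 h0
  obtain ⟨x, y, hxy, ha, hb⟩ := Int.exists_gcd_one hg
  have hg' : (Int.gcd a b : ℤ) ≠ 0 := by exact_mod_cast hg.ne'
  obtain ⟨u, v, huv⟩ := Int.isCoprime_iff_gcd_eq_one.2 hxy
  have hcross : x * d = y * c := by
    apply mul_left_cancel₀ hg'
    calc (Int.gcd a b : ℤ) * (x * d) = (x * Int.gcd a b) * d := by ring
      _ = (y * Int.gcd a b) * c := by rw [← ha, ← hb, h]
      _ = _ := by ring
  refine ⟨x, y, Int.gcd a b, u * c + v * d, ?_, hg', by linarith, by linarith, ?_, ?_⟩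
  · by_contra! hcon
    simp [hcon.1, hcon.2] at huv
  · linear_combination (-c) * huv - v * hcross
  · linear_combination (-d) * huv + u * hcross

open Finset in
lemma exists_mem_proportionalQuadruples {N : ℕ} {a b c d : ℤ} (h0 : a ≠ 0 ∨ b ≠ 0)
    (h : a * d = b * c) (ha : a.natAbs ≤ N) (hb : b.natAbs ≤ N) (hc : c.natAbs ≤ N)
    (hd : d.natAbs ≤ N) :
    ∃ m ∈ Icc 1 N, (a, b, c, d) ∈ proportionalQuadruples N m := by
  obtain ⟨x, y, g, k, hxy, hg, rfl, rfl, rfl, rfl⟩ :=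
    Int.exists_common_factor_of_mul_eq_mul h0 h
  simp only [Int.natAbs_mul] at ha hb hc hd
  set m := max x.natAbs y.natAbs with hm
  have hm1 : 1 ≤ m := by omega
  have hgm : g.natAbs * m ≤ N := by
    rw [hm, ← Nat.mul_max_mul_left]
    exact max_le ha hb
  have hkm : k.natAbs * m ≤ N := by
    rw [hm, ← Nat.mul_max_mul_left]
    exact max_le hc hd
  have hgN := (Nat.le_div_iff_mul_le hm1).2 hgm
  have hkN := (Nat.le_div_iff_mul_le hm1).2 hkm
  refine ⟨m, mem_Icc.2 ⟨hm1, (Nat.le_mul_of_pos_left m (Int.natAbs_pos.2 hg)).trans hgm⟩, ?_⟩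
  refine mem_image.2 ⟨((x, y), g, k), ?_, rfl⟩
  simp only [mem_product, Int.mem_box, mem_Icc]
  exact ⟨hm.symm, by omega, by omega⟩

lemma sum_card_proportionalQuadruples_le (N : ℕ) :
    (∑ m ∈ Finset.Icc 1 N, ((proportionalQuadruples N m).card : ℝ)) ≤
      72 * (N : ℝ) ^ 2 * (1 + Real.log N) := by
  calc (∑ m ∈ Finset.Icc 1 N, ((proportionalQuadruples N m).card : ℝ))
      ≤ ∑ m ∈ Finset.Icc 1 N, 72 * (N : ℝ) ^ 2 * (m : ℝ)⁻¹ := by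
        refine Finset.sum_le_sum fun m hm => ?_
        rw [Finset.mem_Icc] at hm
        exact card_proportionalQuadruples_le hm.1 hm.2
    _ = 72 * (N : ℝ) ^ 2 * (harmonic N : ℝ) := by
        rw [← Finset.mul_sum, harmonic_eq_sum_Icc]
        push_cast
        rfl
    _ ≤ _ := by
        gcongr
        exact harmonic_le_one_add_log N

lemma natAbs_le_floor_of_eisensteinNorm_le {a b : ℤ} {M : ℝ} (hM : 0 ≤ M)
    (h : ((a ^ 2 - a * b + b ^ 2 : ℤ) : ℝ) ≤ 2 * M) :
    a.natAbs ≤ ⌊2 * √M⌋₊ ∧ b.natAbs ≤ ⌊2 * √M⌋₊ := by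
  push_cast at h
  have key : ∀ z : ℤ, (z : ℝ) ^ 2 ≤ 4 * M → z.natAbs ≤ ⌊2 * √M⌋₊ := fun z hz => by
    apply Nat.le_floor
    rw [Nat.cast_natAbs, Int.cast_abs]
    apply abs_le_of_sq_le_sq _ (by positivity)
    rwa [mul_pow, Real.sq_sqrt hM, show (2 : ℝ) ^ 2 = 4 by norm_num]
  exact ⟨key a (by nlinarith [sq_nonneg ((a : ℝ) - 2 * b)]),
    key b (by nlinarith [sq_nonneg ((b : ℝ) - 2 * a)])⟩


/-- For every `ε > 0` there is `C` such that for every `M ≥ 1`, the number of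
quadruples `(a, b, c, d) ∈ ℤ⁴` with `M < a² − ab + b² ≤ 2M`, `M < c² − cd + d² ≤ 2M`
and `ad = bc` is at most `C M^{1+ε}`. -/
theorem diagonal_count :
    ∀ ε : ℝ, 0 < ε → ∃ C : ℝ, ∀ M : ℝ, 1 ≤ M →
      (Set.ncard {q : ℤ × ℤ × ℤ × ℤ |
          (M < ((q.1 ^ 2 - q.1 * q.2.1 + q.2.1 ^ 2 : ℤ) : ℝ) ∧
            ((q.1 ^ 2 - q.1 * q.2.1 + q.2.1 ^ 2 : ℤ) : ℝ) ≤ 2 * M) ∧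
          (M < ((q.2.2.1 ^ 2 - q.2.2.1 * q.2.2.2 + q.2.2.2 ^ 2 : ℤ) : ℝ) ∧
            ((q.2.2.1 ^ 2 - q.2.2.1 * q.2.2.2 + q.2.2.2 ^ 2 : ℤ) : ℝ) ≤ 2 * M) ∧
          q.1 * q.2.2.2 = q.2.1 * q.2.2.1} : ℝ)
        ≤ C * M ^ ((1 : ℝ) + ε) := by
  intro ε hε
  refine ⟨288 * (1 + 4 ^ ε / ε), fun M hM => ?_⟩
  have hM0 : 0 < M := by linarith
  set N := ⌊2 * √M⌋₊
  have hN1 : (1 : ℝ) ≤ N := by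
    have : 1 ≤ N := Nat.le_floor (by
      push_cast
      linarith [Real.one_le_sqrt.2 hM])
    exact_mod_cast this
  have hN2 : (N : ℝ) ^ 2 ≤ 4 * M := by
    have : (N : ℝ) ≤ 2 * √M := Nat.floor_le (by positivity)
    calc (N : ℝ) ^ 2 ≤ (2 * √M) ^ 2 := by gcongr
      _ = 4 * M := by rw [mul_pow, Real.sq_sqrt hM0.le]; norm_num
  have hlog : 1 + Real.log N ≤ (1 + 4 ^ ε / ε) * M ^ ε := by
    have h1 : Real.log N ≤ Real.log (4 * M) :=
      Real.log_le_log (by linarith) (by nlinarith)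
    have h2 : Real.log (4 * M) ≤ (4 * M) ^ ε / ε := Real.log_le_rpow_div (by positivity) hε
    rw [Real.mul_rpow (by norm_num) hM0.le] at h2
    have h3 : 1 ≤ M ^ ε := Real.one_le_rpow hM hε.le
    calc 1 + Real.log N ≤ M ^ ε + 4 ^ ε * M ^ ε / ε := by linarith
      _ = _ := by ring
  calc _ ≤ (((Finset.Icc 1 N).biUnion (proportionalQuadruples N)).card : ℝ) := by
        rw [← Set.ncard_coe_finset]
        refine Nat.cast_le.2 (Set.ncard_le_ncard ?_ (Finset.finite_toSet _))
        rintro ⟨a, b, c, d⟩ ⟨⟨hab, hab'⟩, ⟨-, hcd'⟩, h⟩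
        obtain ⟨ha, hb⟩ := natAbs_le_floor_of_eisensteinNorm_le hM0.le hab'
        obtain ⟨hc, hd⟩ := natAbs_le_floor_of_eisensteinNorm_le hM0.le hcd'
        refine Finset.mem_coe.2 (Finset.mem_biUnion.2
          (exists_mem_proportionalQuadruples ?_ h ha hb hc hd))
        by_contra! h0
        simp only [h0.1, h0.2] at hab
        norm_num at hab
        linarith
    _ ≤ ∑ m ∈ Finset.Icc 1 N, ((proportionalQuadruples N m).card : ℝ) := by
        exact_mod_cast Finset.card_biUnion_le
    _ ≤ 72 * (N : ℝ) ^ 2 * (1 + Real.log N) := sum_card_proportionalQuadruples_le N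
    _ ≤ 72 * (4 * M) * ((1 + 4 ^ ε / ε) * M ^ ε) := by
        have := Real.log_nonneg hN1
        gcongr
    _ = 288 * (1 + 4 ^ ε / ε) * M ^ (1 + ε) := by
        rw [Real.rpow_add hM0, Real.rpow_one]
        ring
end

section
/- Let m and n be coprime positive integers. Then ∑_{(r,s) ∈ ℤ² : r² + 3s² = 4mn} γ_r = (1/6) · ∑_{(a,b) ∈ ℤ² : a² − ab + b² = m} ∑_{(c,d) ∈ ℤ² : c² − cd + d² = n} γ_{2ac − ad − bc − bd}. -/
open Classical

open QuadraticAlgebra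

/-- The ring of Eisenstein integers `ℤ[ω]`, with `ω ^ 2 = -1 - ω`. -/
abbrev EisensteinInt : Type := QuadraticAlgebra ℤ (-1) (-1)

namespace EisensteinInt

theorem norm_eq (z : EisensteinInt) : z.norm = z.re ^ 2 - z.re * z.im + z.im ^ 2 := by
  rw [norm_def]; ring

theorem four_mul_norm (z : EisensteinInt) : 4 * z.norm = z.trace ^ 2 + 3 * z.im ^ 2 := by
  rw [norm_eq, trace_def]; ring

theorem norm_nonneg (z : EisensteinInt) : 0 ≤ z.norm := by
  nlinarith [four_mul_norm z, sq_nonneg z.trace, sq_nonneg z.im]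

theorem norm_eq_zero {z : EisensteinInt} : z.norm = 0 ↔ z = 0 := by
  refine ⟨fun h => ?_, fun h => by rw [h, QuadraticAlgebra.norm_zero]⟩
  have h4 := four_mul_norm z
  have him : z.im = 0 := by
    rw [← sq_eq_zero_iff]; nlinarith [sq_nonneg z.trace, sq_nonneg z.im]
  have hre : z.re = 0 := by simpa [norm_eq, him] using h
  exact QuadraticAlgebra.ext hre him

theorem norm_pos {z : EisensteinInt} (hz : z ≠ 0) : 0 < z.norm :=
  (norm_nonneg z).lt_of_ne' (norm_eq_zero.not.2 hz)

theorem mul_star_self (z : EisensteinInt) : z * star z = (z.norm : EisensteinInt) := by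
  rw [← algebraMap_norm_eq_mul_star]; rfl

/-- Division in `ℤ[ω]`, rounding both coordinates of the exact quotient. -/
noncomputable def quot (x y : EisensteinInt) : EisensteinInt :=
  ⟨round (((x * star y).re : ℚ) / y.norm), round (((x * star y).im : ℚ) / y.norm)⟩

theorem two_mul_abs_sub_round_mul_le (a : ℤ) {b : ℤ} (hb : 0 < b) :
    2 * |a - round ((a : ℚ) / b) * b| ≤ b := by
  have hb' : (0 : ℚ) < b := by exact_mod_cast hb
  have h := mul_le_mul_of_nonneg_right (abs_sub_round ((a : ℚ) / b)) hb'.le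
  have habs : |(a : ℚ) / b - round ((a : ℚ) / b)| * b = |(a : ℚ) - round ((a : ℚ) / b) * b| := by
    conv_lhs => rw [← abs_of_pos hb', ← abs_mul, abs_of_pos hb', sub_mul,
      div_mul_cancel₀ _ hb'.ne']
  rw [habs] at h
  have h2 : 2 * |(a : ℚ) - round ((a : ℚ) / b) * b| ≤ b := by linarith
  exact_mod_cast h2

theorem norm_sub_mul_quot_lt (x : EisensteinInt) {y : EisensteinInt} (hy : y ≠ 0) :
    (x - y * quot x y).norm < y.norm := by
  have hN := norm_pos hy
  have h : (x - y * quot x y).norm * y.norm =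
      (x * star y - (y.norm : EisensteinInt) * quot x y).norm := by
    rw [← QuadraticAlgebra.norm_star y, ← map_mul, QuadraticAlgebra.norm_star, ← mul_star_self y]
    congr 1; ring
  have h1 := two_mul_abs_sub_round_mul_le (x * star y).re hN
  have h2 := two_mul_abs_sub_round_mul_le (x * star y).im hN
  rw [norm_eq (x * star y - _)] at h
  have e1 : (x * star y - (y.norm : EisensteinInt) * quot x y).re =
      (x * star y).re - round (((x * star y).re : ℚ) / y.norm) * y.norm := by
    rw [re_sub, re_mul (y.norm : EisensteinInt), re_intCast, im_intCast]; simp only [quot, Int.cast_id]; ring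
  have e2 : (x * star y - (y.norm : EisensteinInt) * quot x y).im =
      (x * star y).im - round (((x * star y).im : ℚ) / y.norm) * y.norm := by
    rw [im_sub, im_mul (y.norm : EisensteinInt), re_intCast, im_intCast]; simp only [quot, Int.cast_id]; ring
  rw [e1, e2] at h
  generalize (x * star y).re - round (((x * star y).re : ℚ) / y.norm) * y.norm = A at *
  generalize (x * star y).im - round (((x * star y).im : ℚ) / y.norm) * y.norm = B at *
  have hA : (2 * A) ^ 2 ≤ y.norm ^ 2 := by
    apply sq_le_sq'  <;> linarith [neg_abs_le A, le_abs_self A]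
  have hB : (2 * B) ^ 2 ≤ y.norm ^ 2 := by
    apply sq_le_sq'  <;> linarith [neg_abs_le B, le_abs_self B]
  have hAB : 4 * (A ^ 2 - A * B + B ^ 2) ≤ 3 * y.norm ^ 2 := by
    have : -(A * B) * 2 ≤ A ^ 2 + B ^ 2 := by nlinarith [sq_nonneg (A + B)]
    nlinarith
  refine lt_of_mul_lt_mul_right (a := y.norm) ?_ hN.le
  nlinarith

noncomputable instance : EuclideanDomain EisensteinInt :=
  { (inferInstance : CommRing EisensteinInt), (inferInstance : Nontrivial EisensteinInt) with
    quotient := quot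
    remainder := fun x y => x - y * quot x y
    quotient_zero := fun x => by ext <;> simp [quot]
    quotient_mul_add_remainder_eq := fun x y => add_sub_cancel _ _
    r := fun x y => x.norm.toNat < y.norm.toNat
    r_wellFounded := (measure fun x : EisensteinInt => x.norm.toNat).wf
    remainder_lt := fun x y hy =>
      (Int.toNat_lt_toNat (norm_pos hy)).2 (norm_sub_mul_quot_lt x hy)
    mul_left_not_lt := fun x y hy => by
      rw [not_lt, map_mul]
      exact Int.toNat_le_toNat
        (le_mul_of_one_le_right (norm_nonneg x) (norm_pos hy)) }

theorem isCoprime_of_norm {p q : EisensteinInt} (h : IsCoprime p.norm q.norm) :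
    IsCoprime p q := by
  have h' := h.map (Int.castRingHom EisensteinInt)
  simp only [eq_intCast, ← mul_star_self] at h'
  exact h'.of_mul_left_left.of_mul_right_left

theorem exists_mul_eq_of_norm_eq_mul {m n : ℤ} (hm : 0 < m) (hmn : IsCoprime m n)
    {z : EisensteinInt} (hz : z.norm = m * n) :
    ∃ p q : EisensteinInt, p.norm = m ∧ q.norm = n ∧ p * q = z := by
  obtain ⟨d, hd⟩ := (IsPrincipalIdealRing.principal
    (Ideal.span {z, (m : EisensteinInt)})).principal
  rw [Ideal.submodule_span_eq] at hd
  have hdz : d ∣ z := Ideal.mem_span_singleton.1 (hd ▸ Ideal.subset_span (by simp))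
  have hdm : d ∣ (m : EisensteinInt) :=
    Ideal.mem_span_singleton.1 (hd ▸ Ideal.subset_span (by simp))
  obtain ⟨α, β, hαβ⟩ := Ideal.mem_span_pair.1 (hd ▸ Ideal.mem_span_singleton_self d)
  have hm_dvd : m ∣ d.norm := by
    have hdvd : (m : EisensteinInt) ∣ d * star d := by
      have hzz : z * star z = m * n := by rw [mul_star_self, hz]; push_cast; rfl
      refine ⟨α * star α * n + α * z * star β + β * star α * star z + m * β * star β, ?_⟩
      have hs : star (m : EisensteinInt) = m := by ext <;> simp
      rw [← hαβ, star_add, star_mul, star_mul, hs]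
      linear_combination α * star α * hzz
    rw [mul_star_self] at hdvd
    exact algebraMap_dvd_iff_dvd.1 hdvd
  have h_dvd_m : d.norm ∣ m := by
    have h1 : d.norm ∣ m * n := hz ▸ map_dvd QuadraticAlgebra.norm hdz
    have h2 : d.norm ∣ m * m := by
      have := map_dvd QuadraticAlgebra.norm hdm
      rwa [norm_intCast, sq] at this
    obtain ⟨u, v, huv⟩ := hmn
    have : m = u * (m * m) + v * (m * n) := by linear_combination -m * huv
    rw [this]
    exact dvd_add (h2.mul_left u) (h1.mul_left v)
  have hdnorm : d.norm = m := Int.dvd_antisymm (norm_nonneg d) hm.le h_dvd_m hm_dvd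
  obtain ⟨w, rfl⟩ := hdz
  refine ⟨d, w, hdnorm, ?_, rfl⟩
  rw [map_mul, hdnorm] at hz
  exact mul_left_cancel₀ hm.ne' hz

theorem finite_setOf_norm_eq (k : ℤ) : {z : EisensteinInt | z.norm = k}.Finite := by
  refine Set.Finite.subset (Set.Finite.preimage (equivProd (-1 : ℤ) (-1)).injective.injOn
    ((Set.finite_Icc (-(k + 1)) (k + 1)).prod (Set.finite_Icc (-(k + 1)) (k + 1)))) ?_
  rintro z (hz : z.norm = k)
  have hk : 0 ≤ k := hz ▸ norm_nonneg z
  rw [norm_eq] at hz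
  have h1 : z.re ^ 2 ≤ (k + 1) ^ 2 := by nlinarith [sq_nonneg (z.re - 2 * z.im)]
  have h2 : z.im ^ 2 ≤ (k + 1) ^ 2 := by nlinarith [sq_nonneg (z.im - 2 * z.re)]
  exact ⟨abs_le.1 (abs_le_of_sq_le_sq h1 (by lia)), abs_le.1 (abs_le_of_sq_le_sq h2 (by lia))⟩

/-- The finite set of Eisenstein integers of norm `k`. -/
noncomputable def ofNorm (k : ℤ) : Finset EisensteinInt := (finite_setOf_norm_eq k).toFinset

@[simp]
theorem mem_ofNorm {k : ℤ} {z : EisensteinInt} : z ∈ ofNorm k ↔ z.norm = k := by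
  simp [ofNorm]

theorem card_ofNorm_one : (ofNorm 1).card = 6 := by
  have h : ofNorm 1 = {⟨1, 0⟩, ⟨-1, 0⟩, ⟨0, 1⟩, ⟨0, -1⟩, ⟨1, 1⟩, ⟨-1, -1⟩} := by
    ext ⟨x, y⟩
    simp only [mem_ofNorm, norm_eq, Finset.mem_insert, Finset.mem_singleton,
      QuadraticAlgebra.mk.injEq]
    constructor
    · intro h
      have hx := abs_le.1 (abs_le_of_sq_le_sq (a := x) (b := 1)
        (by nlinarith [sq_nonneg (x - 2 * y)]) (by lia))
      have hy := abs_le.1 (abs_le_of_sq_le_sq (a := y) (b := 1)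
        (by nlinarith [sq_nonneg (y - 2 * x)]) (by lia))
      obtain ⟨hx1, hx2⟩ := hx
      obtain ⟨hy1, hy2⟩ := hy
      interval_cases x <;> interval_cases y <;> simp_all
    · rintro (⟨rfl, rfl⟩ | ⟨rfl, rfl⟩ | ⟨rfl, rfl⟩ | ⟨rfl, rfl⟩ | ⟨rfl, rfl⟩ | ⟨rfl, rfl⟩) <;> rfl
  rw [h]
  simp [Finset.card_insert_of_notMem]

theorem card_filter_mul_eq {m n : ℤ} (hm : 0 < m) (hmn : IsCoprime m n)
    {z : EisensteinInt} (hz : z.norm = m * n) :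
    ((ofNorm m ×ˢ ofNorm n).filter fun x => x.1 * x.2 = z).card = 6 := by
  obtain ⟨p, q, hp, hq, rfl⟩ := exists_mul_eq_of_norm_eq_mul hm hmn hz
  have hp0 : p ≠ 0 := by rintro rfl; simp at hp; lia
  rw [← card_ofNorm_one]
  symm
  refine Finset.card_bij (fun u _ => (p * u, q * star u)) ?_ ?_ ?_
  · intro u hu
    rw [mem_ofNorm] at hu
    have hu' : u * star u = 1 := by rw [mul_star_self, hu, Int.cast_one]
    simp only [Finset.mem_filter, Finset.mem_product, mem_ofNorm, map_mul,
      QuadraticAlgebra.norm_star, hu, hp, hq, mul_one, true_and]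
    linear_combination p * q * hu'
  · intro u _ v _ h
    exact mul_left_cancel₀ hp0 (Prod.ext_iff.1 h).1
  · rintro ⟨p', q'⟩ h
    simp only [Finset.mem_filter, Finset.mem_product, mem_ofNorm] at h
    obtain ⟨⟨hp', hq'⟩, h⟩ := h
    have hco : IsCoprime p q' := isCoprime_of_norm (by rwa [hp, hq'])
    obtain ⟨u, rfl⟩ : p ∣ p' := hco.dvd_of_dvd_mul_right (h ▸ dvd_mul_right p q)
    have hu : u.norm = 1 := by
      rw [map_mul, hp] at hp'
      exact mul_left_cancel₀ hm.ne' (hp'.trans (mul_one m).symm)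
    have hu' : u * star u = 1 := by rw [mul_star_self, hu, Int.cast_one]
    have hq : u * q' = q := mul_left_cancel₀ hp0 (by rw [← h]; ring)
    refine ⟨u, mem_ofNorm.2 hu, Prod.ext rfl ?_⟩
    simp only [← hq]
    linear_combination q' * hu'

theorem sum_ofNorm_mul {m n : ℤ} (hm : 0 < m) (hmn : IsCoprime m n)
    (f : EisensteinInt → ℝ) :
    ∑ x ∈ ofNorm m ×ˢ ofNorm n, f (x.1 * x.2) = 6 * ∑ z ∈ ofNorm (m * n), f z := by
  rw [← Finset.sum_fiberwise_of_maps_to' (t := ofNorm (m * n)) (g := fun x : EisensteinInt × EisensteinInt => x.1 * x.2)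
    (fun x hx => ?_) f, Finset.mul_sum]
  · refine Finset.sum_congr rfl fun z hz => ?_
    rw [Finset.sum_const, card_filter_mul_eq hm hmn (mem_ofNorm.1 hz), nsmul_eq_mul]
    norm_num
  · rw [Finset.mem_product, mem_ofNorm, mem_ofNorm] at hx
    rw [mem_ofNorm, map_mul, hx.1, hx.2]

theorem finsum_sq_add_three_mul_sq_eq (k : ℤ) (f : ℤ → ℝ) :
    (∑ᶠ p : ℤ × ℤ, if p.1 ^ 2 + 3 * p.2 ^ 2 = 4 * k then f p.1 else 0) =
      ∑ z ∈ ofNorm k, f z.trace := by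
  have h : (fun p : ℤ × ℤ => if p.1 ^ 2 + 3 * p.2 ^ 2 = 4 * k then f p.1 else 0) =
      Set.indicator {p | p.1 ^ 2 + 3 * p.2 ^ 2 = 4 * k} fun p => f p.1 := by
    ext p; simp [Set.indicator_apply]
  rw [h, ← finsum_mem_def, ← finsum_mem_coe_finset]
  symm
  refine finsum_mem_eq_of_bijOn (fun z : EisensteinInt => (z.trace, z.im)) ⟨?_, ?_, ?_⟩
    fun _ _ => rfl
  · intro z hz
    rw [Finset.mem_coe, mem_ofNorm] at hz
    rw [Set.mem_ofPred_eq, ← four_mul_norm, hz]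
  · intro z _ w _ hzw
    simp only [Prod.mk.injEq, trace_def] at hzw
    exact QuadraticAlgebra.ext (by lia) hzw.2
  · rintro ⟨r, s⟩ (hrs : r ^ 2 + 3 * s ^ 2 = 4 * k)
    have hpar : Even (r + s) := by
      have : Even (r ^ 2 + 3 * s ^ 2) := hrs ▸ ⟨2 * k, by ring⟩
      simpa [Int.even_add, Int.even_mul, Int.even_pow,
        (by decide : ¬ Even (3 : ℤ))] using this
    obtain ⟨x, hx⟩ := hpar
    have htr : (⟨x, s⟩ : EisensteinInt).trace = r := by rw [trace_def]; lia
    refine ⟨⟨x, s⟩, ?_, Prod.ext htr rfl⟩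
    have h4 := four_mul_norm ⟨x, s⟩
    rw [htr] at h4
    rw [Finset.mem_coe, mem_ofNorm]
    lia

theorem finsum_norm_eq_and_norm_eq (m n : ℤ) (f : ℤ → ℝ) :
    (∑ᶠ q : (ℤ × ℤ) × ℤ × ℤ,
        if q.1.1 ^ 2 - q.1.1 * q.1.2 + q.1.2 ^ 2 = m ∧
            q.2.1 ^ 2 - q.2.1 * q.2.2 + q.2.2 ^ 2 = n then
          f (2 * q.1.1 * q.2.1 - q.1.1 * q.2.2 - q.1.2 * q.2.1 - q.1.2 * q.2.2)
        else 0) =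
      ∑ x ∈ ofNorm m ×ˢ ofNorm n, f (x.1 * x.2).trace := by
  let e := (equivProd (-1 : ℤ) (-1)).prodCongr (equivProd (-1 : ℤ) (-1))
  rw [← finsum_comp_equiv e, ← finsum_mem_coe_finset, finsum_mem_def]
  refine finsum_congr fun ⟨z, w⟩ => ?_
  rw [Set.indicator_apply]
  refine if_congr ?_ (congrArg f ?_) rfl
  · simp only [Finset.mem_coe, Finset.mem_product, mem_ofNorm, norm_eq]
    rfl
  · simp only [trace_def, re_mul, im_mul]
    change 2 * z.re * w.re - z.re * w.im - z.im * w.re - z.im * w.im = _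
    ring

end EisensteinInt

/-- Multiplicative splitting of `a_{mn}` for coprime `m, n`:
`∑_{r² + 3s² = 4mn} γ_r
  = (1/6) ∑_{a² − ab + b² = m} ∑_{c² − cd + d² = n} γ_{2ac − ad − bc − bd}`. -/
theorem aseq_coprime_splitting (m n : ℕ) (hm : 0 < m) (hn : 0 < n)
    (hmn : Nat.Coprime m n) :
    (∑ᶠ p : ℤ × ℤ, if p.1 ^ 2 + 3 * p.2 ^ 2 = 4 * (m : ℤ) * (n : ℤ) then gam p.1 else 0) =
      (1 / 6 : ℝ) * ∑ᶠ q : (ℤ × ℤ) × ℤ × ℤ,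
        if q.1.1 ^ 2 - q.1.1 * q.1.2 + q.1.2 ^ 2 = (m : ℤ) ∧
            q.2.1 ^ 2 - q.2.1 * q.2.2 + q.2.2 ^ 2 = (n : ℤ) then
          gam (2 * q.1.1 * q.2.1 - q.1.1 * q.2.2 - q.1.2 * q.2.1 - q.1.2 * q.2.2)
        else 0 := by
  rw [EisensteinInt.finsum_norm_eq_and_norm_eq,
    EisensteinInt.sum_ofNorm_mul (by exact_mod_cast hm) (Nat.isCoprime_iff_coprime.2 hmn)
      fun z => gam z.trace, ← EisensteinInt.finsum_sq_add_three_mul_sq_eq]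
  simp only [← mul_assoc]
  ring
end
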